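/- arXiv:math/0701100 — 7 statements merged into one kernel-verified Lean document; each statement's English description precedes it below -/
import Mathlib

section
/- Let T > 0, 0 < ε ≤ 1, 0 < ε₁ ≤ ε, and let (u, ρ) be a smooth bounded solution on Π = ℝ × (0,T) of the viscous isothermal Euler system ∂_t ρ + ∂_x(ρu) = ε ∂_xx ρ + 2ε₁ ∂_x u, ∂_t(ρu) + ∂_x(ρu²) + ∂_x ρ = ε ∂_xx(ρu) + ε₁ ∂_x(u²) + 2ε₁ ∂_x(ln ρ), with ρ ≥ 2ε₁ > 0, and with initial data ρ(·,0) = ρ₀^ε + 2ε₁, u(·,0) = u₀^ε, where 0 ≤ ρ₀^ε ≤ M and |u₀^ε| ≤ u₁ pointwise. Then for every compact set K ⊂ Π there is a constant c depending only on K, M, u₁ and T (and not on ε, ε₁) such that ∬_K ( ε (∂_x ρ)²/ρ + ε ρ (∂_x u)² ) dx dt ≤ c. -/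
open MeasureTheory Real Set Filter Topology

noncomputable section

/-- The space-time domain `Π = ℝ × (0,T)`, a point `p = (x,t)`. -/
def PiT (T : ℝ) : Set (ℝ × ℝ) := {p : ℝ × ℝ | 0 < p.2 ∧ p.2 < T}

/-- Partial derivative in the space variable `x` (first coordinate). -/
def pdx (g : ℝ × ℝ → ℝ) (p : ℝ × ℝ) : ℝ := deriv (fun y => g (y, p.2)) p.1

/-- Partial derivative in the time variable `t` (second coordinate). -/
def pdt (g : ℝ × ℝ → ℝ) (p : ℝ × ℝ) : ℝ := deriv (fun τ => g (p.1, τ)) p.2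

/-- Second partial derivative in the space variable `x`. -/
def pdxx (g : ℝ × ℝ → ℝ) (p : ℝ × ℝ) : ℝ :=
  deriv (fun y => deriv (fun y' => g (y', p.2)) y) p.1

/-- The viscous regularization of the isothermal Euler system:
`∂_t ρ + ∂_x(ρu) = ε ∂_xx ρ + 2ε₁ ∂_x u`,
`∂_t(ρu) + ∂_x(ρu²) + ∂_x ρ = ε ∂_xx(ρu) + ε₁ ∂_x(u²) + 2ε₁ ∂_x(ln ρ)`
on `ℝ × (0,T)`. -/
def IsViscousSolution (T ε ε₁ : ℝ) (u ρ : ℝ × ℝ → ℝ) : Prop :=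
  ∀ x t : ℝ, 0 < t → t < T →
    (pdt ρ (x, t) + pdx (fun p => ρ p * u p) (x, t)
      = ε * pdxx ρ (x, t) + 2 * ε₁ * pdx u (x, t)) ∧
    (pdt (fun p => ρ p * u p) (x, t) + pdx (fun p => ρ p * u p ^ 2) (x, t)
        + pdx ρ (x, t)
      = ε * pdxx (fun p => ρ p * u p) (x, t)
        + ε₁ * pdx (fun p => u p ^ 2) (x, t)
        + 2 * ε₁ * pdx (fun p => Real.log (ρ p)) (x, t))

theorem pdx_eq_fderiv {g : ℝ × ℝ → ℝ} (hg : ContDiff ℝ (⊤ : ℕ∞) g) (p : ℝ × ℝ) :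
    pdx g p = fderiv ℝ g p (1, 0) := by
  have h := (hg.differentiable (by simp) p).hasFDerivAt
  have h1 : HasDerivAt (fun y : ℝ => (y, p.2)) ((1 : ℝ), (0 : ℝ)) p.1 :=
    (hasDerivAt_id p.1).prodMk (hasDerivAt_const p.1 p.2)
  exact (HasFDerivAt.comp_hasDerivAt (f := fun y : ℝ => (y, p.2)) p.1 h h1).deriv

theorem pdt_eq_fderiv {g : ℝ × ℝ → ℝ} (hg : ContDiff ℝ (⊤ : ℕ∞) g) (p : ℝ × ℝ) :
    pdt g p = fderiv ℝ g p (0, 1) := by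
  have h := (hg.differentiable (by simp) p).hasFDerivAt
  have h1 : HasDerivAt (fun y : ℝ => (p.1, y)) ((0 : ℝ), (1 : ℝ)) p.2 :=
    (hasDerivAt_const p.2 p.1).prodMk (hasDerivAt_id p.2)
  exact (HasFDerivAt.comp_hasDerivAt (f := fun y : ℝ => (p.1, y)) p.2 h h1).deriv

theorem contDiff_pdx {g : ℝ × ℝ → ℝ} (hg : ContDiff ℝ (⊤ : ℕ∞) g) :
    ContDiff ℝ (⊤ : ℕ∞) (pdx g) := by
  rw [funext (pdx_eq_fderiv hg)]
  exact (hg.fderiv_right (m := (⊤ : ℕ∞)) (by simp)).clm_apply contDiff_const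

theorem contDiff_pdt {g : ℝ × ℝ → ℝ} (hg : ContDiff ℝ (⊤ : ℕ∞) g) :
    ContDiff ℝ (⊤ : ℕ∞) (pdt g) := by
  rw [funext (pdt_eq_fderiv hg)]
  exact (hg.fderiv_right (m := (⊤ : ℕ∞)) (by simp)).clm_apply contDiff_const

theorem hasDerivAt_pdx {g : ℝ × ℝ → ℝ} (hg : ContDiff ℝ (⊤ : ℕ∞) g) (x t : ℝ) :
    HasDerivAt (fun y => g (y, t)) (pdx g (x, t)) x := by
  have h : ContDiff ℝ (⊤ : ℕ∞) fun y : ℝ => g (y, t) :=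
    hg.comp (contDiff_id.prodMk contDiff_const)
  exact (h.differentiable (by simp) x).hasDerivAt

theorem hasDerivAt_pdt {g : ℝ × ℝ → ℝ} (hg : ContDiff ℝ (⊤ : ℕ∞) g) (x t : ℝ) :
    HasDerivAt (fun τ => g (x, τ)) (pdt g (x, t)) t := by
  have h : ContDiff ℝ (⊤ : ℕ∞) fun τ : ℝ => g (x, τ) :=
    hg.comp (contDiff_const.prodMk contDiff_id)
  exact (h.differentiable (by simp) t).hasDerivAt

theorem tsupport_pdx_subset {g : ℝ × ℝ → ℝ} (hg : ContDiff ℝ (⊤ : ℕ∞) g) :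
    tsupport (pdx g) ⊆ tsupport g := by
  rw [funext (pdx_eq_fderiv hg)]
  exact tsupport_fderiv_apply_subset ℝ _

theorem tsupport_pdt_subset {g : ℝ × ℝ → ℝ} (hg : ContDiff ℝ (⊤ : ℕ∞) g) :
    tsupport (pdt g) ⊆ tsupport g := by
  rw [funext (pdt_eq_fderiv hg)]
  exact tsupport_fderiv_apply_subset ℝ _

theorem integral_mul_pdx_eq_neg {φ g : ℝ × ℝ → ℝ} (hφ : ContDiff ℝ (⊤ : ℕ∞) φ)
    (hc : HasCompactSupport φ) (hg : ContDiff ℝ (⊤ : ℕ∞) g) :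
    ∫ p, φ p * pdx g p = -∫ p, pdx φ p * g p := by
  have hcx : HasCompactSupport (pdx φ) := hc.mono' ((subset_tsupport _).trans
    (tsupport_pdx_subset hφ))
  have i1 : Integrable fun p => pdx φ p * g p :=
    ((contDiff_pdx hφ).continuous.mul hg.continuous).integrable_of_hasCompactSupport
      hcx.mul_right
  have i2 : Integrable fun p => φ p * pdx g p :=
    (hφ.continuous.mul (contDiff_pdx hg).continuous).integrable_of_hasCompactSupport
      hc.mul_right
  have i3 : Integrable fun p => φ p * g p :=
    (hφ.continuous.mul hg.continuous).integrable_of_hasCompactSupport hc.mul_right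
  simp only [pdx_eq_fderiv hφ, pdx_eq_fderiv hg] at i1 i2 ⊢
  exact integral_mul_fderiv_eq_neg_fderiv_mul_of_integrable i1 i2 i3
    (fun p _ => hφ.differentiable (by simp) p) (fun p _ => hg.differentiable (by simp) p)

theorem integral_mul_pdt_eq_neg {φ g : ℝ × ℝ → ℝ} (hφ : ContDiff ℝ (⊤ : ℕ∞) φ)
    (hc : HasCompactSupport φ) (hg : ContDiff ℝ (⊤ : ℕ∞) g) :
    ∫ p, φ p * pdt g p = -∫ p, pdt φ p * g p := by
  have hct : HasCompactSupport (pdt φ) := hc.mono' ((subset_tsupport _).trans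
    (tsupport_pdt_subset hφ))
  have i1 : Integrable fun p => pdt φ p * g p :=
    ((contDiff_pdt hφ).continuous.mul hg.continuous).integrable_of_hasCompactSupport
      hct.mul_right
  have i2 : Integrable fun p => φ p * pdt g p :=
    (hφ.continuous.mul (contDiff_pdt hg).continuous).integrable_of_hasCompactSupport
      hc.mul_right
  have i3 : Integrable fun p => φ p * g p :=
    (hφ.continuous.mul hg.continuous).integrable_of_hasCompactSupport hc.mul_right
  simp only [pdt_eq_fderiv hφ, pdt_eq_fderiv hg] at i1 i2 ⊢
  exact integral_mul_fderiv_eq_neg_fderiv_mul_of_integrable i1 i2 i3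
    (fun p _ => hφ.differentiable (by simp) p) (fun p _ => hg.differentiable (by simp) p)

theorem exists_contDiff_cutoff {K U : Set (ℝ × ℝ)} (hK : IsCompact K) (hU : IsOpen U)
    (hKU : K ⊆ U) :
    ∃ φ : ℝ × ℝ → ℝ, ContDiff ℝ (⊤ : ℕ∞) φ ∧ HasCompactSupport φ ∧ tsupport φ ⊆ U ∧
      (∀ p, 0 ≤ φ p) ∧ ∀ p ∈ K, φ p = 1 := by
  obtain ⟨L, hL, hKL, hLU⟩ := exists_compact_between hK hU hKU
  obtain ⟨φ, hφ, hr, hs, h1⟩ := exists_contMDiff_support_eq_eq_one_iff (n := (⊤ : ℕ∞))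
    (modelWithCornersSelf ℝ (ℝ × ℝ)) isOpen_interior hK.isClosed hKL
  have ht : tsupport φ ⊆ L := by
    rw [tsupport, hs]
    exact closure_minimal interior_subset hL.isClosed
  exact ⟨φ, hφ.contDiff, hL.of_isClosed_subset (isClosed_tsupport _) ht, ht.trans hLU,
    fun p => (hr (mem_range_self p)).1, fun p hp => (h1 p).1 hp⟩

theorem deriv_deriv_nonpos_of_isLocalMax {f : ℝ → ℝ} {a : ℝ} (h : IsLocalMax f a)
    (hf : ContinuousAt f a) : deriv (deriv f) a ≤ 0 := by
  by_contra! hpos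
  have hmin := isLocalMin_of_deriv_deriv_pos hpos h.deriv_eq_zero hf
  have hc : f =ᶠ[𝓝 a] fun _ => f a := by
    filter_upwards [h, hmin] with y h1 h2 using le_antisymm h1 h2
  have := hc.deriv.deriv_eq
  simp at this
  linarith

theorem HasDerivAt.nonneg_of_le_left {f : ℝ → ℝ} {f' a s : ℝ} (hf : HasDerivAt f f' a)
    (hs : s < a) (hle : ∀ y ∈ Ioo s a, f y ≤ f a) : 0 ≤ f' := by
  have h := (hasDerivWithinAt_iff_tendsto_slope' (s := Iio a) (by simp)).1
    (hf.hasDerivWithinAt (s := Iio a))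
  refine ge_of_tendsto h ?_
  filter_upwards [Ioo_mem_nhdsLT hs] with y hy
  rw [slope_def_field]
  exact div_nonneg_of_nonpos (sub_nonpos.2 (hle y hy)) (sub_nonpos.2 hy.2.le)

/-- Weak maximum principle for bounded subsolutions of a linear parabolic equation with bounded
drift on the whole line. -/
theorem le_of_parabolic_subsolution {T ε A B C : ℝ} {W b : ℝ × ℝ → ℝ}
    (hW : ContDiff ℝ (⊤ : ℕ∞) W) (hε : 0 < ε) (hε1 : ε ≤ 1)
    (hC : ∀ p, W p ≤ C) (hb : ∀ p, |b p| ≤ B) (h0 : ∀ x, W (x, 0) ≤ A)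
    (heq : ∀ x t, 0 < t → t < T →
      pdt W (x, t) + b (x, t) * pdx W (x, t) ≤ ε * pdx (pdx W) (x, t))
    {x t : ℝ} (ht : 0 < t) (htT : t < T) : W (x, t) ≤ A := by
  by_contra! hlt
  set l : ℝ := B + 3 with hl
  have hB : 0 ≤ B := (abs_nonneg _).trans (hb 0)
  obtain ⟨δ, hδ, hδW⟩ : ∃ δ > 0, δ * (exp (l * t) * (1 + x ^ 2)) < W (x, t) - A := by
    have hq : 0 < exp (l * t) * (1 + x ^ 2) := by positivity
    refine ⟨(W (x, t) - A) / (2 * (exp (l * t) * (1 + x ^ 2))), by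
      apply div_pos <;> linarith, ?_⟩
    have : (W (x, t) - A) / (2 * (exp (l * t) * (1 + x ^ 2))) * (exp (l * t) * (1 + x ^ 2))
        = (W (x, t) - A) / 2 := by field_simp
    linarith
  set Φ : ℝ × ℝ → ℝ := fun p => W p - A - δ * (exp (l * p.2) * (1 + p.1 ^ 2)) with hΦ
  have hΦs : ContDiff ℝ (⊤ : ℕ∞) Φ := by fun_prop
  have h1 : 0 ≤ |C - A| / δ := by positivity
  obtain ⟨R, hRx, hR⟩ : ∃ R, |x| < R ∧ C - A < δ * (1 + R ^ 2) := by
    refine ⟨|x| + 1 + |C - A| / δ, by linarith, ?_⟩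
    have h2 : δ * (|C - A| / δ) = |C - A| := by field_simp
    have h3 := le_abs_self (C - A)
    have h4 := abs_nonneg x
    have h5 : |C - A| / δ < 1 + (|x| + 1 + |C - A| / δ) ^ 2 := by nlinarith
    have := mul_lt_mul_of_pos_left h5 hδ
    linarith
  have hx := abs_lt.1 hRx
  have hcpt : IsCompact (Icc (-R) R ×ˢ Icc 0 t) := isCompact_Icc.prod isCompact_Icc
  have hmem : (x, t) ∈ Icc (-R) R ×ˢ Icc 0 t := ⟨⟨hx.1.le, hx.2.le⟩, ht.le, le_rfl⟩
  obtain ⟨⟨y, s⟩, ⟨hy, hs⟩, hmax⟩ := hcpt.exists_isMaxOn ⟨_, hmem⟩ hΦs.continuous.continuousOn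
  simp only at hy hs
  have hpos : 0 < Φ (y, s) := by
    have h := hmax hmem
    rw [mem_ofPred_eq] at h
    have : 0 < Φ (x, t) := by simp only [hΦ]; linarith
    linarith
  have hexp : 1 ≤ exp (l * s) := one_le_exp (by have := hs.1; positivity)
  have hs0 : 0 < s := by
    rcases hs.1.eq_or_lt with h | h
    · subst h
      have h1 := h0 y
      have : 0 ≤ δ * (exp (l * 0) * (1 + y ^ 2)) := by positivity
      simp only [hΦ] at hpos
      linarith
    · exact h
  have hyR : y ^ 2 < R ^ 2 := by
    by_contra! hle
    have h1 := hC (y, s)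
    have h2 : 1 * (1 + R ^ 2) ≤ exp (l * s) * (1 + y ^ 2) := by gcongr
    have h3 := mul_le_mul_of_nonneg_left h2 hδ.le
    simp only [hΦ] at hpos
    linarith
  have hyR' := abs_lt.1 (abs_lt_of_sq_lt_sq hyR (by linarith [abs_nonneg x]))
  have hloc : IsLocalMax (fun z => Φ (z, s)) y := by
    filter_upwards [Ioo_mem_nhds hyR'.1 hyR'.2] with z hz
    exact hmax (show (z, s) ∈ Icc (-R) R ×ˢ Icc 0 t from ⟨⟨hz.1.le, hz.2.le⟩, hs⟩)
  have hdx : ∀ z, HasDerivAt (fun z => Φ (z, s))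
      (pdx W (z, s) - δ * (exp (l * s) * (2 * z))) z := by
    intro z
    have h1 : HasDerivAt (fun z : ℝ => 1 + z ^ 2) (2 * z) z := by
      simpa using (hasDerivAt_pow 2 z).const_add 1
    exact ((hasDerivAt_pdx hW z s).sub_const A).sub ((h1.const_mul (exp (l * s))).const_mul δ)
  have hdxx : HasDerivAt (deriv fun z => Φ (z, s))
      (pdx (pdx W) (y, s) - δ * (exp (l * s) * 2)) y := by
    rw [show (deriv fun z => Φ (z, s)) = _ from funext fun z => (hdx z).deriv]
    have h1 : HasDerivAt (fun z : ℝ => 2 * z) 2 y := by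
      simpa using (hasDerivAt_id y).const_mul (2 : ℝ)
    exact (hasDerivAt_pdx (contDiff_pdx hW) y s).sub ((h1.const_mul _).const_mul δ)
  have hdt : HasDerivAt (fun τ => Φ (y, τ))
      (pdt W (y, s) - δ * (exp (l * s) * l * (1 + y ^ 2))) s := by
    have h1 : HasDerivAt (fun τ => exp (l * τ)) (exp (l * s) * l) s := by
      simpa using ((hasDerivAt_id s).const_mul l).exp
    exact ((hasDerivAt_pdt hW y s).sub_const A).sub ((h1.mul_const (1 + y ^ 2)).const_mul δ)
  have e1 : pdx W (y, s) - δ * (exp (l * s) * (2 * y)) = 0 :=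
    (hdx y).deriv.symm.trans hloc.deriv_eq_zero
  have e2 : pdx (pdx W) (y, s) - δ * (exp (l * s) * 2) ≤ 0 :=
    hdxx.deriv ▸ deriv_deriv_nonpos_of_isLocalMax hloc (hdx y).continuousAt
  have e3 : 0 ≤ pdt W (y, s) - δ * (exp (l * s) * l * (1 + y ^ 2)) :=
    hdt.nonneg_of_le_left hs0 fun τ hτ =>
      hmax (show (y, τ) ∈ Icc (-R) R ×ˢ Icc 0 t from ⟨hy, hτ.1.le, hτ.2.le.trans hs.2⟩)
  have e4 := heq y s hs0 (hs.2.trans_lt htT)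
  have e5 : pdx W (y, s) = δ * (exp (l * s) * (2 * y)) := by linarith
  rw [e5] at e4
  set E := δ * exp (l * s) with hE
  have hE0 : 0 < E := by positivity
  have e6 : -(b (y, s) * (2 * y)) ≤ B * (1 + y ^ 2) := by
    have h1 := hb (y, s)
    calc -(b (y, s) * (2 * y)) ≤ |b (y, s) * (2 * y)| := neg_le_abs _
      _ = |b (y, s)| * (2 * |y|) := by rw [abs_mul, abs_mul]; simp
      _ ≤ B * (1 + y ^ 2) := by
        gcongr
        nlinarith [sq_nonneg (|y| - 1), sq_abs y]
  have e7 : ε * pdx (pdx W) (y, s) ≤ 2 * E := by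
    have : ε * pdx (pdx W) (y, s) ≤ ε * (2 * E) := by gcongr; simp only [hE]; linarith
    nlinarith
  have e8 : E * (l * (1 + y ^ 2)) - E * (B * (1 + y ^ 2)) ≤ 2 * E := by
    have := mul_le_mul_of_nonneg_left e6 hE0.le
    have h9 : E * (l * (1 + y ^ 2)) ≤ pdt W (y, s) := by simp only [hE]; linarith
    have h10 : b (y, s) * (δ * (exp (l * s) * (2 * y))) = -(E * -(b (y, s) * (2 * y))) := by
      simp only [hE]; ring
    linarith
  rw [hl] at e8
  nlinarith [mul_nonneg hE0.le (sq_nonneg y)]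

theorem pdx_mul {f g : ℝ × ℝ → ℝ} (hf : ContDiff ℝ (⊤ : ℕ∞) f) (hg : ContDiff ℝ (⊤ : ℕ∞) g)
    (p : ℝ × ℝ) : pdx (fun p => f p * g p) p = pdx f p * g p + f p * pdx g p :=
  ((hasDerivAt_pdx hf p.1 p.2).mul (hasDerivAt_pdx hg p.1 p.2)).deriv

/-- The viscous system in terms of the velocity instead of the momentum. -/
theorem IsViscousSolution.velocity_form {T ε ε₁ : ℝ} {u ρ : ℝ × ℝ → ℝ}
    (h : IsViscousSolution T ε ε₁ u ρ) (hu : ContDiff ℝ (⊤ : ℕ∞) u)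
    (hρ : ContDiff ℝ (⊤ : ℕ∞) ρ) (hpos : ∀ p, 0 < ρ p) {x t : ℝ} (ht : 0 < t) (htT : t < T) :
    pdt ρ (x, t) + u (x, t) * pdx ρ (x, t) + (ρ (x, t) - 2 * ε₁) * pdx u (x, t)
        = ε * pdx (pdx ρ) (x, t) ∧
      ρ (x, t) * (pdt u (x, t) + u (x, t) * pdx u (x, t)) + pdx ρ (x, t)
        = ε * (ρ (x, t) * pdx (pdx u) (x, t) + 2 * pdx ρ (x, t) * pdx u (x, t))
          + 2 * ε₁ * (pdx ρ (x, t) / ρ (x, t)) := by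
  obtain ⟨e1, e2⟩ := h x t ht htT
  have hux := hasDerivAt_pdx hu x t
  have hρx := hasDerivAt_pdx hρ x t
  have hut := hasDerivAt_pdt hu x t
  have hρt := hasDerivAt_pdt hρ x t
  have m1 : pdx (fun p => ρ p * u p) (x, t)
      = pdx ρ (x, t) * u (x, t) + ρ (x, t) * pdx u (x, t) := pdx_mul hρ hu _
  have m2 : pdt (fun p => ρ p * u p) (x, t)
      = pdt ρ (x, t) * u (x, t) + ρ (x, t) * pdt u (x, t) := (hρt.mul hut).deriv
  have m3 : pdx (fun p => ρ p * u p ^ 2) (x, t) = pdx ρ (x, t) * u (x, t) ^ 2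
      + ρ (x, t) * (2 * u (x, t) * pdx u (x, t)) := by
    refine (hρx.mul (hux.pow 2)).deriv.trans ?_
    simp
  have m4 : pdx (fun p => u p ^ 2) (x, t) = 2 * u (x, t) * pdx u (x, t) := by
    refine (hux.pow 2).deriv.trans ?_
    simp
  have m5 : pdx (fun p => Real.log (ρ p)) (x, t) = pdx ρ (x, t) / ρ (x, t) :=
    (hρx.log (hpos _).ne').deriv
  have m6 : pdxx (fun p => ρ p * u p) (x, t) = pdx (pdx ρ) (x, t) * u (x, t)
      + 2 * (pdx ρ (x, t) * pdx u (x, t)) + ρ (x, t) * pdx (pdx u) (x, t) := by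
    change pdx (pdx (fun p => ρ p * u p)) (x, t) = _
    rw [show pdx (fun p => ρ p * u p) = _ from funext (pdx_mul hρ hu)]
    refine (((hasDerivAt_pdx (contDiff_pdx hρ) x t).mul hux).add
      (hρx.mul (hasDerivAt_pdx (contDiff_pdx hu) x t))).deriv.trans ?_
    ring
  have m7 : pdxx ρ (x, t) = pdx (pdx ρ) (x, t) := rfl
  rw [m1, m7] at e1
  rw [m2, m3, m6, m4, m5] at e2
  constructor
  · linear_combination e1
  · linear_combination e2 - u (x, t) * e1

/-- The exponentials `ρ exp (± u)` of the Riemann invariants stay below their initial bound. -/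
theorem IsViscousSolution.mul_exp_le {T ε ε₁ A C σ : ℝ} {u ρ : ℝ × ℝ → ℝ}
    (h : IsViscousSolution T ε ε₁ u ρ) (hσ : σ ^ 2 = 1) (hε : 0 < ε) (hε1 : ε ≤ 1) (hε₁ : 0 < ε₁)
    (hu : ContDiff ℝ (⊤ : ℕ∞) u) (hρ : ContDiff ℝ (⊤ : ℕ∞) ρ)
    (hC : ∀ p, |u p| ≤ C ∧ |ρ p| ≤ C) (hlow : ∀ p, 2 * ε₁ ≤ ρ p)
    (h0 : ∀ x, ρ (x, 0) * exp (σ * u (x, 0)) ≤ A) {x t : ℝ} (ht : 0 < t) (htT : t < T) :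
    ρ (x, t) * exp (σ * u (x, t)) ≤ A := by
  have hpos : ∀ p, 0 < ρ p := fun p => by linarith [hlow p]
  have hσ1 : |σ| = 1 := by rw [← abs_one]; exact (sq_eq_sq_iff_abs_eq_abs _ _).1 (by simpa using hσ)
  have hC0 : 0 ≤ C := (abs_nonneg _).trans (hC 0).1
  have hW : ContDiff ℝ (⊤ : ℕ∞) fun p => ρ p * exp (σ * u p) := by fun_prop
  refine le_of_parabolic_subsolution (T := T) (ε := ε) (B := C + 1) (C := C * exp C)
    (W := fun p => ρ p * exp (σ * u p)) (b := fun p => u p + σ * ((ρ p - 2 * ε₁) / ρ p))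
    hW hε hε1 ?_ ?_ h0 ?_ ht htT
  · intro p
    have h1 : σ * u p ≤ C := (le_abs_self _).trans (by rw [abs_mul, hσ1, one_mul]; exact (hC p).1)
    have h2 := (le_abs_self _).trans (hC p).2
    exact mul_le_mul h2 (exp_le_exp.2 h1) (exp_pos _).le hC0
  · intro p
    refine (abs_add_le _ _).trans (add_le_add (hC p).1 ?_)
    rw [abs_mul, hσ1, one_mul, abs_of_nonneg (div_nonneg (sub_nonneg.2 (hlow p)) (hpos p).le),
      div_le_one (hpos p)]
    linarith
  · intro y s hs hsT
    obtain ⟨e1, e2⟩ := h.velocity_form hu hρ hpos (x := y) hs hsT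
    have d1 : ∀ p, pdx (fun p => ρ p * exp (σ * u p)) p
        = (pdx ρ p + σ * (ρ p * pdx u p)) * exp (σ * u p) := by
      intro p
      refine ((hasDerivAt_pdx hρ p.1 p.2).mul
        ((hasDerivAt_pdx hu p.1 p.2).const_mul σ).exp).deriv.trans ?_
      ring
    have d2 : pdt (fun p => ρ p * exp (σ * u p)) (y, s)
        = (pdt ρ (y, s) + σ * (ρ (y, s) * pdt u (y, s))) * exp (σ * u (y, s)) := by
      refine ((hasDerivAt_pdt hρ y s).mul
        ((hasDerivAt_pdt hu y s).const_mul σ).exp).deriv.trans ?_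
      ring
    have d3 : pdx (pdx (fun p => ρ p * exp (σ * u p))) (y, s)
        = (pdx (pdx ρ) (y, s) + 2 * σ * (pdx ρ (y, s) * pdx u (y, s))
          + σ * (ρ (y, s) * pdx (pdx u) (y, s)) + ρ (y, s) * pdx u (y, s) ^ 2)
          * exp (σ * u (y, s)) := by
      rw [funext d1]
      have hux := hasDerivAt_pdx hu y s
      have hρx := hasDerivAt_pdx hρ y s
      refine (((hasDerivAt_pdx (contDiff_pdx hρ) y s).add
        ((hρx.mul (hasDerivAt_pdx (contDiff_pdx hu) y s)).const_mul σ)).mul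
        (hux.const_mul σ).exp).deriv.trans ?_
      simp only [Pi.add_apply, Pi.mul_apply]
      linear_combination (ρ (y, s) * pdx u (y, s) ^ 2 * exp (σ * u (y, s))) * hσ
    rw [d1, d2, d3]
    have key : (pdt ρ (y, s) + σ * (ρ (y, s) * pdt u (y, s)))
        + (u (y, s) + σ * ((ρ (y, s) - 2 * ε₁) / ρ (y, s)))
          * (pdx ρ (y, s) + σ * (ρ (y, s) * pdx u (y, s)))
        = ε * (pdx (pdx ρ) (y, s) + 2 * σ * (pdx ρ (y, s) * pdx u (y, s))
          + σ * (ρ (y, s) * pdx (pdx u) (y, s)) + ρ (y, s) * pdx u (y, s) ^ 2)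
          - ε * (ρ (y, s) * pdx u (y, s) ^ 2) := by
      have hinv := mul_inv_cancel₀ (hpos (y, s)).ne'
      linear_combination e1 + σ * e2 + (ρ (y, s) - 2 * ε₁) * pdx u (y, s) * hσ
        + (σ * pdx ρ (y, s) + σ ^ 2 * (ρ (y, s) - 2 * ε₁) * pdx u (y, s)) * hinv
    have hn : 0 ≤ ε * (ρ (y, s) * pdx u (y, s) ^ 2) := by have := hpos (y, s); positivity
    have hE := exp_pos (σ * u (y, s))
    have := mul_nonneg hn hE.le
    linear_combination exp (σ * u (y, s)) * key + this

/-- The mechanical entropy of the isothermal Euler system. -/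
def entropy (u ρ : ℝ × ℝ → ℝ) (p : ℝ × ℝ) : ℝ := ρ p * u p ^ 2 / 2 + ρ p * Real.log (ρ p)

/-- The flux of `entropy` for the regularized system. -/
def entropyFlux (ε₁ : ℝ) (u ρ : ℝ × ℝ → ℝ) (p : ℝ × ℝ) : ℝ :=
  ρ p * u p ^ 3 / 2 + ρ p * (u p * Real.log (ρ p)) + ρ p * u p
    - 2 * ε₁ * (u p * Real.log (ρ p) + u p + u p ^ 3 / 6)

theorem contDiff_entropy {u ρ : ℝ × ℝ → ℝ} (hu : ContDiff ℝ (⊤ : ℕ∞) u)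
    (hρ : ContDiff ℝ (⊤ : ℕ∞) ρ) (hpos : ∀ p, 0 < ρ p) :
    ContDiff ℝ (⊤ : ℕ∞) (entropy u ρ) := by
  have hl := hρ.log fun p => (hpos p).ne'
  unfold entropy
  fun_prop

theorem contDiff_entropyFlux {ε₁ : ℝ} {u ρ : ℝ × ℝ → ℝ} (hu : ContDiff ℝ (⊤ : ℕ∞) u)
    (hρ : ContDiff ℝ (⊤ : ℕ∞) ρ) (hpos : ∀ p, 0 < ρ p) :
    ContDiff ℝ (⊤ : ℕ∞) (entropyFlux ε₁ u ρ) := by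
  have hl := hρ.log fun p => (hpos p).ne'
  unfold entropyFlux
  fun_prop

theorem IsViscousSolution.entropy_balance {T ε ε₁ : ℝ} {u ρ : ℝ × ℝ → ℝ}
    (h : IsViscousSolution T ε ε₁ u ρ) (hu : ContDiff ℝ (⊤ : ℕ∞) u)
    (hρ : ContDiff ℝ (⊤ : ℕ∞) ρ) (hpos : ∀ p, 0 < ρ p) {x t : ℝ} (ht : 0 < t) (htT : t < T) :
    ε * pdx ρ (x, t) ^ 2 / ρ (x, t) + ε * ρ (x, t) * pdx u (x, t) ^ 2
      = ε * pdx (pdx (entropy u ρ)) (x, t) - pdx (entropyFlux ε₁ u ρ) (x, t)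
        - pdt (entropy u ρ) (x, t) := by
  obtain ⟨e1, e2⟩ := h.velocity_form hu hρ hpos (x := x) ht htT
  have hne : ∀ p, ρ p ≠ 0 := fun p => (hpos p).ne'
  have hux := hasDerivAt_pdx hu x t
  have hρx := hasDerivAt_pdx hρ x t
  have hlx := hρx.log (hne _)
  have hut := hasDerivAt_pdt hu x t
  have hρt := hasDerivAt_pdt hρ x t
  have d1 : ∀ p, pdx (entropy u ρ) p = pdx ρ p * u p ^ 2 / 2 + ρ p * (u p * pdx u p)
      + pdx ρ p * Real.log (ρ p) + pdx ρ p := by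
    intro p
    have hρ' := hasDerivAt_pdx hρ p.1 p.2
    refine (((hρ'.mul ((hasDerivAt_pdx hu p.1 p.2).pow 2)).div_const 2).add
      (hρ'.mul (hρ'.log (hne _)))).deriv.trans ?_
    have := hne p
    simp
    field_simp
    ring
  have d2 : pdt (entropy u ρ) (x, t) = pdt ρ (x, t) * u (x, t) ^ 2 / 2
      + ρ (x, t) * (u (x, t) * pdt u (x, t))
      + pdt ρ (x, t) * Real.log (ρ (x, t)) + pdt ρ (x, t) := by
    refine (((hρt.mul (hut.pow 2)).div_const 2).add
      (hρt.mul (hρt.log (hne _)))).deriv.trans ?_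
    have := hne (x, t)
    simp
    field_simp
    ring
  have d3 : pdx (pdx (entropy u ρ)) (x, t) = pdx (pdx ρ) (x, t) * u (x, t) ^ 2 / 2
      + 2 * (pdx ρ (x, t) * (u (x, t) * pdx u (x, t))) + ρ (x, t) * pdx u (x, t) ^ 2
      + ρ (x, t) * (u (x, t) * pdx (pdx u) (x, t)) + pdx (pdx ρ) (x, t) * Real.log (ρ (x, t))
      + pdx ρ (x, t) * (pdx ρ (x, t) / ρ (x, t)) + pdx (pdx ρ) (x, t) := by
    rw [funext d1]
    have hρxx := hasDerivAt_pdx (contDiff_pdx hρ) x t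
    refine (((((hρxx.mul (hux.pow 2)).div_const 2).add
      (hρx.mul (hux.mul (hasDerivAt_pdx (contDiff_pdx hu) x t)))).add
      (hρxx.mul hlx)).add hρxx).deriv.trans ?_
    simp
    ring
  have d4 : pdx (entropyFlux ε₁ u ρ) (x, t) = pdx ρ (x, t) * u (x, t) ^ 3 / 2
      + ρ (x, t) * (3 * u (x, t) ^ 2 * pdx u (x, t)) / 2
      + pdx ρ (x, t) * (u (x, t) * Real.log (ρ (x, t)))
      + ρ (x, t) * (pdx u (x, t) * Real.log (ρ (x, t)) + u (x, t) * (pdx ρ (x, t) / ρ (x, t)))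
      + (pdx ρ (x, t) * u (x, t) + ρ (x, t) * pdx u (x, t))
      - 2 * ε₁ * (pdx u (x, t) * Real.log (ρ (x, t)) + u (x, t) * (pdx ρ (x, t) / ρ (x, t))
        + pdx u (x, t) + 3 * u (x, t) ^ 2 * pdx u (x, t) / 6) := by
    refine (((((hρx.mul (hux.pow 3)).div_const 2).add (hρx.mul (hux.mul hlx))).add
      (hρx.mul hux)).sub ((((hux.mul hlx).add hux).add
        ((hux.pow 3).div_const 6)).const_mul (2 * ε₁))).deriv.trans ?_
    simp
    ring
  rw [d2, d3, d4]
  have hinv := mul_inv_cancel₀ (hne (x, t))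
  linear_combination (u (x, t) ^ 2 / 2 + Real.log (ρ (x, t)) + 1) * e1 + u (x, t) * e2
    + pdx ρ (x, t) * u (x, t) * hinv

theorem mul_log_sq_le {r A : ℝ} (hr : 0 < r) (hA : r ≤ A) : r * Real.log r ^ 2 ≤ 2 + A ^ 3 := by
  have hA0 : 0 < A := hr.trans_le hA
  rcases le_total 1 r with h | h
  · have h1 := Real.log_le_self hr.le
    have h2 := Real.log_nonneg h
    calc r * Real.log r ^ 2 ≤ A * A ^ 2 := by gcongr; exact h1.trans hA
      _ ≤ 2 + A ^ 3 := by linarith [show A * A ^ 2 = A ^ 3 by ring]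
  · have h1 : 0 ≤ -Real.log r := by linarith [Real.log_nonpos hr.le h]
    have h2 := Real.pow_div_factorial_le_exp _ h1 2
    rw [Real.exp_neg, Real.exp_log hr] at h2
    have h3 := mul_le_mul_of_nonneg_left h2 hr.le
    rw [mul_inv_cancel₀ hr.ne'] at h3
    have : r * ((-Real.log r) ^ 2 / (Nat.factorial 2 : ℝ)) = r * Real.log r ^ 2 / 2 := by
      simp [Nat.factorial]; ring
    have : 0 < A ^ 3 := by positivity
    linarith

theorem mul_abs_pow_le {r v A : ℝ} (hr : 0 < r) (h1 : r * exp v ≤ A) (h2 : r * exp (-v) ≤ A)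
    (n : ℕ) : r * |v| ^ n ≤ n.factorial * A := by
  have h : r * exp |v| ≤ A := by
    rcases abs_choice v with h | h <;> rw [h] <;> assumption
  have h3 := Real.pow_div_factorial_le_exp _ (abs_nonneg v) n
  have hn : (0 : ℝ) < n.factorial := by positivity
  rw [div_le_iff₀ hn] at h3
  calc r * |v| ^ n ≤ r * (exp |v| * n.factorial) := by gcongr
    _ = n.factorial * (r * exp |v|) := by ring
    _ ≤ n.factorial * A := by gcongr

theorem abs_entropy_le_and_abs_entropyFlux_le {ε₁ A : ℝ} {u ρ : ℝ × ℝ → ℝ} {p : ℝ × ℝ}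
    (hε₁ : 0 < ε₁) (hlow : 2 * ε₁ ≤ ρ p) (h1 : ρ p * exp (u p) ≤ A)
    (h2 : ρ p * exp (-u p) ≤ A) :
    |entropy u ρ p| ≤ 10 * A + A ^ 3 + 10 ∧
      |entropyFlux ε₁ u ρ p| ≤ 10 * A + A ^ 3 + 10 := by
  have hr : 0 < ρ p := by linarith
  have k0 := mul_abs_pow_le hr h1 h2 0
  have k1 := mul_abs_pow_le hr h1 h2 1
  have k2 := mul_abs_pow_le hr h1 h2 2
  have k3 := mul_abs_pow_le hr h1 h2 3
  simp [Nat.factorial] at k0 k1 k2 k3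
  have kl := mul_log_sq_le hr k0
  have hA : 0 < A := hr.trans_le k0
  have hA3 : 0 < A ^ 3 := by positivity
  unfold entropy entropyFlux
  set r := ρ p
  set v := u p
  set l := Real.log r
  have kvl : r * (|v| * |l|) ≤ A + 1 + A ^ 3 / 2 := by
    have := mul_nonneg hr.le (sq_nonneg (|v| - |l|))
    have h3 : r * (|v| - |l|) ^ 2 = r * v ^ 2 + r * l ^ 2 - 2 * (r * (|v| * |l|)) := by
      rw [sub_sq, sq_abs, sq_abs]; ring
    linarith
  have kl1 : r * |l| ≤ A + 1 + A ^ 3 / 2 := by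
    have := mul_nonneg hr.le (sq_nonneg (1 - |l|))
    have h3 : r * (1 - |l|) ^ 2 = r + r * l ^ 2 - 2 * (r * |l|) := by
      rw [sub_sq, sq_abs]; ring
    linarith
  constructor
  · refine (abs_add_le _ _).trans ?_
    rw [abs_div, abs_mul, abs_mul, abs_of_pos hr, abs_of_nonneg (sq_nonneg v), abs_two]
    linarith
  · have hm : |2 * ε₁ * (v * l + v + v ^ 3 / 6)| ≤ r * (|v| * |l| + |v| + |v| ^ 3 / 6) := by
      rw [abs_mul, abs_of_pos (by positivity)]
      gcongr
      refine (abs_add_le _ _).trans (add_le_add ((abs_add_le _ _).trans ?_) ?_)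
      · rw [abs_mul]
      · rw [abs_div, abs_pow]; norm_num
    refine (abs_sub _ _).trans ((add_le_add ((abs_add_le _ _).trans
      (add_le_add (abs_add_le _ _) le_rfl)) hm).trans ?_)
    rw [abs_div, abs_mul, abs_mul, abs_mul, abs_mul, abs_of_pos hr, abs_pow, abs_two]
    linarith

/-- Lemma 3.3: entropy dissipation estimate.  For smooth
bounded solutions `(u, ρ)` of the viscous isothermal Euler system with
`ρ ≥ 2ε₁ > 0`, `0 < ε ≤ 1`, `0 < ε₁ ≤ ε`, and initial data as in Lemma 3.2,
the local entropy dissipation `∬_K (ε (∂_x ρ)²/ρ + ε ρ (∂_x u)²) dx dt` is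
bounded on every compact `K ⊆ Π` by a constant depending only on `K`, `M`,
`u₁` and `T` (not on `ε, ε₁`). -/
theorem viscous_entropy_dissipation_estimate
    (T M u₁ : ℝ) (hT : 0 < T)
    (K : Set (ℝ × ℝ)) (hK : IsCompact K) (hKsub : K ⊆ PiT T) :
    ∃ c : ℝ, ∀ ε ε₁ : ℝ, 0 < ε → ε ≤ 1 → 0 < ε₁ → ε₁ ≤ ε →
    ∀ ρ₀ u₀ : ℝ → ℝ, ∀ u ρ : ℝ × ℝ → ℝ,
      ContDiff ℝ (⊤ : ℕ∞) u → ContDiff ℝ (⊤ : ℕ∞) ρ →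
      (∃ C : ℝ, ∀ p, |u p| ≤ C ∧ |ρ p| ≤ C) →
      (∀ p, 2 * ε₁ ≤ ρ p) →
      IsViscousSolution T ε ε₁ u ρ →
      (∀ x : ℝ, ρ (x, 0) = ρ₀ x + 2 * ε₁) →
      (∀ x : ℝ, u (x, 0) = u₀ x) →
      (∀ x : ℝ, 0 ≤ ρ₀ x ∧ ρ₀ x ≤ M) →
      (∀ x : ℝ, |u₀ x| ≤ u₁) →
      ∫ p in K, (ε * (pdx ρ p) ^ 2 / ρ p + ε * ρ p * (pdx u p) ^ 2) ≤ c := by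
  have hopen : IsOpen (PiT T) :=
    (isOpen_lt continuous_const continuous_snd).inter (isOpen_lt continuous_snd continuous_const)
  obtain ⟨φ, hφ, hφc, hφT, hφ0, hφ1⟩ := exists_contDiff_cutoff hK hopen hKsub
  set A : ℝ := (|M| + 2) * exp |u₁| with hA
  set B : ℝ := 10 * A + A ^ 3 + 10 with hB
  refine ⟨∫ p, B * (|pdx (pdx φ) p| + |pdx φ p| + |pdt φ p|), ?_⟩
  intro ε ε₁ hε hε1 hε₁ hε₁ε ρ₀ u₀ u ρ hu hρ ⟨C, hC⟩ hlow hsol hρ0 hu0 hρ₀ hu₀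
  have hpos : ∀ p, 0 < ρ p := fun p => by linarith [hlow p]
  have hinit : ∀ σ : ℝ, |σ| = 1 → ∀ x, ρ (x, 0) * exp (σ * u (x, 0)) ≤ A := by
    intro σ hσ x
    rw [hρ0, hu0, hA]
    have h1 : σ * u₀ x ≤ |u₁| := by
      refine (le_abs_self _).trans ?_
      rw [abs_mul, hσ, one_mul]
      exact (hu₀ x).trans (le_abs_self _)
    have h2 : ρ₀ x + 2 * ε₁ ≤ |M| + 2 := by linarith [(hρ₀ x).2, le_abs_self M]
    exact mul_le_mul h2 (exp_le_exp.2 h1) (exp_pos _).le (by positivity)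
  have hbound : ∀ p ∈ PiT T, |entropy u ρ p| ≤ B ∧ |entropyFlux ε₁ u ρ p| ≤ B := by
    rintro ⟨x, t⟩ ⟨ht, htT⟩
    refine abs_entropy_le_and_abs_entropyFlux_le hε₁ (hlow _) ?_ ?_
    · simpa using hsol.mul_exp_le (σ := 1) (by norm_num) hε hε1 hε₁ hu hρ hC hlow
        (hinit 1 (by norm_num)) ht htT
    · simpa using hsol.mul_exp_le (σ := -1) (by norm_num) hε hε1 hε₁ hu hρ hC hlow
        (hinit (-1) (by norm_num)) ht htT
  have hη := contDiff_entropy hu hρ hpos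
  have hq := contDiff_entropyFlux (ε₁ := ε₁) hu hρ hpos
  have hφx := contDiff_pdx hφ
  have hφxx := contDiff_pdx hφx
  have hφt := contDiff_pdt hφ
  have sx := tsupport_pdx_subset hφ
  have sxx := (tsupport_pdx_subset hφx).trans sx
  have st := tsupport_pdt_subset hφ
  have cx : HasCompactSupport (pdx φ) := hφc.mono' ((subset_tsupport _).trans sx)
  have cxx : HasCompactSupport (pdx (pdx φ)) := hφc.mono' ((subset_tsupport _).trans sxx)
  have ct : HasCompactSupport (pdt φ) := hφc.mono' ((subset_tsupport _).trans st)
  set D : ℝ × ℝ → ℝ := fun p => ε * (pdx ρ p) ^ 2 / ρ p + ε * ρ p * (pdx u p) ^ 2 with hD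
  have hDc : Continuous D :=
    ((continuous_const.mul ((contDiff_pdx hρ).continuous.pow 2)).div hρ.continuous
      fun p => (hpos p).ne').add
      ((continuous_const.mul hρ.continuous).mul ((contDiff_pdx hu).continuous.pow 2))
  have hD0 : ∀ p, 0 ≤ φ p * D p := fun p => by
    have := hpos p
    have := hφ0 p
    positivity
  have i0 : Integrable fun p => φ p * D p :=
    (hφ.continuous.mul hDc).integrable_of_hasCompactSupport hφc.mul_right
  have i1 : Integrable fun p => φ p * pdx (pdx (entropy u ρ)) p :=
    (hφ.continuous.mul (contDiff_pdx (contDiff_pdx hη)).continuous).integrable_of_hasCompactSupport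
      hφc.mul_right
  have i2 : Integrable fun p => φ p * pdx (entropyFlux ε₁ u ρ) p :=
    (hφ.continuous.mul (contDiff_pdx hq).continuous).integrable_of_hasCompactSupport
      hφc.mul_right
  have i3 : Integrable fun p => φ p * pdt (entropy u ρ) p :=
    (hφ.continuous.mul (contDiff_pdt hη).continuous).integrable_of_hasCompactSupport
      hφc.mul_right
  have j1 : Integrable fun p => pdx (pdx φ) p * entropy u ρ p :=
    (hφxx.continuous.mul hη.continuous).integrable_of_hasCompactSupport cxx.mul_right
  have j2 : Integrable fun p => pdx φ p * entropyFlux ε₁ u ρ p :=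
    (hφx.continuous.mul hq.continuous).integrable_of_hasCompactSupport cx.mul_right
  have j3 : Integrable fun p => pdt φ p * entropy u ρ p :=
    (hφt.continuous.mul hη.continuous).integrable_of_hasCompactSupport ct.mul_right
  have i12 : Integrable fun p => ε * (φ p * pdx (pdx (entropy u ρ)) p)
      - φ p * pdx (entropyFlux ε₁ u ρ) p := (i1.const_mul ε).sub i2
  have j12 : Integrable fun p => ε * (pdx (pdx φ) p * entropy u ρ p)
      + pdx φ p * entropyFlux ε₁ u ρ p := (j1.const_mul ε).add j2
  have hpt : ∀ p, φ p * D p = ε * (φ p * pdx (pdx (entropy u ρ)) p)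
      - φ p * pdx (entropyFlux ε₁ u ρ) p - φ p * pdt (entropy u ρ) p := by
    rintro ⟨x, t⟩
    by_cases hp : (x, t) ∈ tsupport φ
    · obtain ⟨ht, htT⟩ := hφT hp
      simp only [hD]
      rw [hsol.entropy_balance hu hρ hpos ht htT]
      ring
    · simp [image_eq_zero_of_notMem_tsupport hp]
  have hmul : ∀ {f g : ℝ × ℝ → ℝ}, tsupport f ⊆ tsupport φ → (∀ p ∈ PiT T, |g p| ≤ B) →
      ∀ p, f p * g p ≤ B * |f p| := by
    intro f g hf hg p
    by_cases hp : p ∈ tsupport f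
    · calc f p * g p ≤ |f p * g p| := le_abs_self _
        _ = |g p| * |f p| := by rw [abs_mul, mul_comm]
        _ ≤ B * |f p| := by gcongr; exact hg p (hφT (hf hp))
    · simp [image_eq_zero_of_notMem_tsupport hp]
  calc ∫ p in K, D p = ∫ p in K, φ p * D p :=
        setIntegral_congr_fun hK.measurableSet fun p hp => by simp only [hφ1 p hp, one_mul]
    _ ≤ ∫ p, φ p * D p := setIntegral_le_integral i0 (Eventually.of_forall hD0)
    _ = ε * (∫ p, φ p * pdx (pdx (entropy u ρ)) p)
        - (∫ p, φ p * pdx (entropyFlux ε₁ u ρ) p) - ∫ p, φ p * pdt (entropy u ρ) p := by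
      rw [funext hpt, integral_sub i12 i3, integral_sub (i1.const_mul ε) i2, integral_const_mul]
    _ = ε * (∫ p, pdx (pdx φ) p * entropy u ρ p)
        + (∫ p, pdx φ p * entropyFlux ε₁ u ρ p) + ∫ p, pdt φ p * entropy u ρ p := by
      rw [integral_mul_pdx_eq_neg hφ hφc (contDiff_pdx hη), integral_mul_pdx_eq_neg hφx cx hη,
        integral_mul_pdx_eq_neg hφ hφc hq, integral_mul_pdt_eq_neg hφ hφc hη]
      ring
    _ = ∫ p, (ε * (pdx (pdx φ) p * entropy u ρ p) + pdx φ p * entropyFlux ε₁ u ρ p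
        + pdt φ p * entropy u ρ p) := by
      rw [integral_add j12 j3, integral_add (j1.const_mul ε) j2,
        integral_const_mul]
    _ ≤ ∫ p, B * (|pdx (pdx φ) p| + |pdx φ p| + |pdt φ p|) := by
      refine integral_mono (j12.add j3)
        ((((hφxx.continuous.integrable_of_hasCompactSupport cxx).abs.add
          (hφx.continuous.integrable_of_hasCompactSupport cx).abs).add
          (hφt.continuous.integrable_of_hasCompactSupport ct).abs).const_mul B) fun p => ?_
      have h1 := hmul sxx (fun p hp => (hbound p hp).1) p
      have h2 := hmul sx (fun p hp => (hbound p hp).2) p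
      have h3 := hmul st (fun p hp => (hbound p hp).1) p
      have h4 : 0 ≤ B * |pdx (pdx φ) p| := by positivity
      have h5 : ε * (pdx (pdx φ) p * entropy u ρ p) ≤ B * |pdx (pdx φ) p| :=
        (mul_le_mul_of_nonneg_left h1 hε.le).trans (mul_le_of_le_one_left h4 hε1)
      simp only
      linarith
end
end

section
/- Let c > 0 be a constant. If (m, ρ) is an entropy solution of the isothermal Euler system on Π = ℝ × (0,T) with initial data (m₀, ρ₀), then (cm, cρ) is an entropy solution of the same system with initial data (cm₀, cρ₀). -/
open MeasureTheory Real Set Filter Topology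

noncomputable section

/-- The domain `Ω = {0 < ρ < ρ*, |m| < c* ρ (1 + |ln ρ|)}` in the `(m,ρ)`-plane. -/
def OmegaSet (cs rs : ℝ) : Set (ℝ × ℝ) :=
  {p : ℝ × ℝ | 0 < p.2 ∧ p.2 < rs ∧ |p.1| < cs * p.2 * (1 + |Real.log p.2|)}

/-- `(η, q)`, functions of `(m, ρ)`, form an entropy pair for the isothermal Euler
system: they are `C²` on every `Ω`, `C¹` on its closure, and satisfy
`q_m = (2m/ρ) η_m + η_ρ` and `q_ρ = (1 − m²/ρ²) η_m`. -/
def IsEntropyPair (η q : ℝ → ℝ → ℝ) : Prop :=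
  (∀ cs rs : ℝ, 0 < cs → 0 < rs →
    ContDiffOn ℝ 2 (fun p : ℝ × ℝ => η p.1 p.2) (OmegaSet cs rs) ∧
    ContDiffOn ℝ 2 (fun p : ℝ × ℝ => q p.1 p.2) (OmegaSet cs rs) ∧
    ContDiffOn ℝ 1 (fun p : ℝ × ℝ => η p.1 p.2) (closure (OmegaSet cs rs)) ∧
    ContDiffOn ℝ 1 (fun p : ℝ × ℝ => q p.1 p.2) (closure (OmegaSet cs rs))) ∧
  (∀ m ρ : ℝ, 0 < ρ →
    deriv (fun m' => q m' ρ) m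
      = (2 * m / ρ) * deriv (fun m' => η m' ρ) m + deriv (fun ρ' => η m ρ') ρ ∧
    deriv (fun ρ' => q m ρ') ρ
      = (1 - m ^ 2 / ρ ^ 2) * deriv (fun m' => η m' ρ) m)

/-- A weak entropy pair vanishes at the vacuum. -/
def IsWeakEntropyPair (η q : ℝ → ℝ → ℝ) : Prop :=
  IsEntropyPair η q ∧ η 0 0 = 0 ∧ q 0 0 = 0

/-- A convex weak entropy pair: moreover `η` is convex in the conservative
variables `(ρ, m)`. -/
def IsConvexWeakEntropyPair (η q : ℝ → ℝ → ℝ) : Prop :=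
  IsWeakEntropyPair η q ∧ ConvexOn ℝ Set.univ (fun p : ℝ × ℝ => η p.2 p.1)

/-- Nonnegative test functions `φ ∈ C_c^∞(ℝ × [0,T))`. -/
def IsTestFun (T : ℝ) (φ : ℝ × ℝ → ℝ) : Prop :=
  ContDiff ℝ (⊤ : ℕ∞) φ ∧ HasCompactSupport φ ∧ (∀ p, 0 ≤ φ p) ∧
  (∀ p : ℝ × ℝ, T ≤ p.2 → φ p = 0)

/-- The entropy inequality on `Π = ℝ × (0,T)`, including the initial data term:
`∬_Π (η(m,ρ) ∂_t φ + q(m,ρ) ∂_x φ) dx dt + ∫_ℝ η(m₀,ρ₀) φ(·,0) dx ≥ 0`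
for every convex weak entropy pair and every nonnegative test function. -/
def EntropyInequality (T : ℝ) (m₀ ρ₀ : ℝ → ℝ) (m ρ : ℝ × ℝ → ℝ) : Prop :=
  ∀ η q : ℝ → ℝ → ℝ, IsConvexWeakEntropyPair η q →
    ∀ φ : ℝ × ℝ → ℝ, IsTestFun T φ →
      0 ≤ (∫ p in PiT T, (η (m p) (ρ p) * fderiv ℝ φ p (0, 1)
              + q (m p) (ρ p) * fderiv ℝ φ p (1, 0)))
          + ∫ x : ℝ, η (m₀ x) (ρ₀ x) * φ (x, 0)

/-- An entropy solution of the Cauchy problem for the isothermal Euler system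
on `Π = ℝ × (0,T)` with initial data `(m₀, ρ₀)`: a pair `(m,ρ) ∈ L^∞(Π)` with
`ρ ≥ 0` and `|m| ≤ c' ρ (1+|ln ρ|)` a.e. for some `c' > 0`, satisfying the
entropy inequality for all convex weak entropy pairs. -/
def IsEntropySolution (T : ℝ) (m₀ ρ₀ : ℝ → ℝ) (m ρ : ℝ × ℝ → ℝ) : Prop :=
  Measurable m ∧ Measurable ρ ∧
  (∃ C : ℝ, ∀ᵐ p ∂(volume.restrict (PiT T)), |m p| ≤ C ∧ |ρ p| ≤ C) ∧
  (∃ c' : ℝ, 0 < c' ∧ ∀ᵐ p ∂(volume.restrict (PiT T)),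
    0 ≤ ρ p ∧ |m p| ≤ c' * ρ p * (1 + |Real.log (ρ p)|)) ∧
  EntropyInequality T m₀ ρ₀ m ρ

/-- The growth factor `1 + |log ρ|` is stable under scaling, up to a constant. -/
theorem one_add_abs_log_le_mul {c ρ : ℝ} (hc : 0 < c) (hρ : 0 ≤ ρ) :
    1 + |Real.log ρ| ≤ (1 + |Real.log c|) * (1 + |Real.log (c * ρ)|) := by
  rcases hρ.eq_or_lt with rfl | hρ
  · simp
  · have hlog : Real.log ρ = Real.log (c * ρ) - Real.log c := by
      rw [Real.log_mul hc.ne' hρ.ne']; ring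
    have hle : |Real.log ρ| ≤ |Real.log (c * ρ)| + |Real.log c| := by
      rw [hlog]; exact abs_sub _ _
    nlinarith [mul_nonneg (abs_nonneg (Real.log c)) (abs_nonneg (Real.log (c * ρ)))]

theorem mapsTo_smul_OmegaSet {c cs : ℝ} (rs : ℝ) (hc : 0 < c) (hcs : 0 < cs) :
    MapsTo (fun p : ℝ × ℝ => c • p) (OmegaSet cs rs)
      (OmegaSet (cs * (1 + |Real.log c|)) (c * rs)) := by
  rintro ⟨m, ρ⟩ ⟨h₁, h₂, h₃⟩
  simp only at h₁ h₂ h₃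
  refine ⟨mul_pos hc h₁, mul_lt_mul_of_pos_left h₂ hc, ?_⟩
  simp only [Prod.smul_mk, smul_eq_mul, abs_mul, abs_of_pos hc]
  calc c * |m| < c * (cs * ρ * (1 + |Real.log ρ|)) := mul_lt_mul_of_pos_left h₃ hc
    _ ≤ c * (cs * ρ * ((1 + |Real.log c|) * (1 + |Real.log (c * ρ)|))) := by
        gcongr; exact one_add_abs_log_le_mul hc h₁.le
    _ = _ := by ring

theorem IsEntropyPair.comp_mul {η q : ℝ → ℝ → ℝ} (h : IsEntropyPair η q) {c : ℝ} (hc : 0 < c) :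
    IsEntropyPair (fun m ρ => η (c * m) (c * ρ)) (fun m ρ => q (c * m) (c * ρ)) := by
  refine ⟨fun cs rs hcs hrs => ?_, fun m ρ hρ => ?_⟩
  · obtain ⟨h₁, h₂, h₃, h₄⟩ := h.1 (cs * (1 + |Real.log c|)) (c * rs) (by positivity)
      (by positivity)
    have hmaps := mapsTo_smul_OmegaSet rs hc hcs
    have hclosure := hmaps.closure (continuous_const_smul c)
    have hsmooth (n : WithTop ℕ∞) (s : Set (ℝ × ℝ)) :
        ContDiffOn ℝ n (fun p : ℝ × ℝ => c • p) s := (contDiff_const_smul c).contDiffOn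
    exact ⟨h₁.comp (hsmooth _ _) hmaps, h₂.comp (hsmooth _ _) hmaps,
      h₃.comp (hsmooth _ _) hclosure, h₄.comp (hsmooth _ _) hclosure⟩
  · obtain ⟨h₁, h₂⟩ := h.2 (c * m) (c * ρ) (mul_pos hc hρ)
    have e₁ := deriv_comp_mul_left c (fun x => q x (c * ρ)) m
    have e₂ := deriv_comp_mul_left c (fun x => η x (c * ρ)) m
    have e₃ := deriv_comp_mul_left c (fun x => q (c * m) x) ρ
    have e₄ := deriv_comp_mul_left c (fun x => η (c * m) x) ρ
    simp only [smul_eq_mul] at e₁ e₂ e₃ e₄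
    rw [e₁, e₂, e₃, e₄, h₁, h₂]
    constructor <;> field_simp

theorem IsConvexWeakEntropyPair.comp_mul {η q : ℝ → ℝ → ℝ} (h : IsConvexWeakEntropyPair η q)
    {c : ℝ} (hc : 0 < c) :
    IsConvexWeakEntropyPair (fun m ρ => η (c * m) (c * ρ)) (fun m ρ => q (c * m) (c * ρ)) := by
  refine ⟨⟨h.1.1.comp_mul hc, by simpa using h.1.2.1, by simpa using h.1.2.2⟩, ?_⟩
  exact h.2.comp_linearMap (c • LinearMap.id : ℝ × ℝ →ₗ[ℝ] ℝ × ℝ)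

/-- Lemma 3.6: scaling invariance.  If `(m, ρ)` is an entropy
solution with initial data `(m₀, ρ₀)`, then `(cm, cρ)` is an entropy solution
with initial data `(cm₀, cρ₀)`, for any constant `c > 0`. -/
theorem entropy_solution_scaling
    (T c : ℝ) (hT : 0 < T) (hc : 0 < c)
    (m₀ ρ₀ : ℝ → ℝ) (m ρ : ℝ × ℝ → ℝ)
    (h : IsEntropySolution T m₀ ρ₀ m ρ) :
    IsEntropySolution T (fun x => c * m₀ x) (fun x => c * ρ₀ x)
      (fun p => c * m p) (fun p => c * ρ p) := by
  obtain ⟨hm, hρ, ⟨C, hC⟩, ⟨c', hc', hbound⟩, hineq⟩ := h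
  refine ⟨hm.const_mul c, hρ.const_mul c, ⟨c * C, ?_⟩,
    ⟨c' * (1 + |Real.log c|), by positivity, ?_⟩, ?_⟩
  · filter_upwards [hC] with p hp
    simp only [abs_mul, abs_of_pos hc]
    exact ⟨mul_le_mul_of_nonneg_left hp.1 hc.le, mul_le_mul_of_nonneg_left hp.2 hc.le⟩
  · filter_upwards [hbound] with p hp
    refine ⟨mul_nonneg hc.le hp.1, ?_⟩
    have hρp := hp.1
    rw [abs_mul, abs_of_pos hc]
    calc c * |m p| ≤ c * (c' * ρ p * (1 + |Real.log (ρ p)|)) := by gcongr; exact hp.2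
      _ ≤ c * (c' * ρ p * ((1 + |Real.log c|) * (1 + |Real.log (c * ρ p)|))) := by
          gcongr; exact one_add_abs_log_le_mul hc hp.1
      _ = _ := by ring
  · exact fun η q hηq φ hφ => hineq _ _ (hηq.comp_mul hc) φ hφ
end
end

section
/- Let A = 1/4 and let f̄ : ℝ → ℝ be defined by f̄(m) = f(m) for m ≤ 0 and f̄(m) = 0 for m > 0, where f(m) = Σ_{n≥0} (A^n/n!)² (−1)^n m^n. Then f̄ solves the ordinary differential equation m y'' + y' + A² y = 0 in the sense of distributions on ℝ; that is, for every test function φ ∈ C_c^∞(ℝ), ∫_ℝ f̄(m) [ (m φ(m))'' − φ'(m) + A² φ(m) ] dm = 0. -/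
open MeasureTheory Real Set Filter Topology

noncomputable section

/-- The function `f(m) = Σ_{n≥0} (A^n/n!)² (−1)^n m^n` with `A = 1/4`,
representable by the Bessel function of order zero. -/
def fker (m : ℝ) : ℝ :=
  ∑' n : ℕ, (((1 : ℝ) / 4) ^ n / (n.factorial : ℝ)) ^ 2 * (-1) ^ n * m ^ n

/-- The entropy kernel `χ(R,u) = e^{R/2} f(u² − R²) 1_{u² ≤ R²}` of the
isothermal Euler equations. -/
def chiKer (R u : ℝ) : ℝ :=
  if u ^ 2 ≤ R ^ 2 then Real.exp (R / 2) * fker (u ^ 2 - R ^ 2) else 0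

/-- An everywhere absolutely convergent real power series may be differentiated termwise. -/
theorem hasDerivAt_tsum_mul_pow {c : ℕ → ℝ} (hc : ∀ r : ℝ, Summable fun n => |c n| * r ^ n)
    (x : ℝ) :
    HasDerivAt (fun y => ∑' n, c n * y ^ n) (∑' n : ℕ, c n * (n * x ^ (n - 1))) x := by
  refine hasDerivAt_tsum_of_isPreconnected (t := Metric.ball 0 (|x| + 1)) (y₀ := 0)
    (hc (2 * (|x| + 1))) Metric.isOpen_ball (convex_ball _ _).isPreconnected
    (fun n y _ => (hasDerivAt_pow n y).const_mul (c n)) (fun n y hy => ?_)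
    (Metric.mem_ball_self (by positivity)) ?_ (by simp)
  · have hy' : |y| ≤ |x| + 1 := by
      rw [mem_ball_zero_iff, Real.norm_eq_abs] at hy
      exact hy.le
    have hR : 1 ≤ |x| + 1 := by linarith [abs_nonneg x]
    have hpow : |y| ^ (n - 1) ≤ (|x| + 1) ^ n :=
      (pow_le_pow_left₀ (abs_nonneg y) hy' _).trans (pow_le_pow_right₀ hR (Nat.sub_le n 1))
    have hn : (n : ℝ) ≤ 2 ^ n := by exact_mod_cast n.lt_two_pow_self.le
    rw [Real.norm_eq_abs, abs_mul, abs_mul, abs_pow, Nat.abs_cast, mul_pow]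
    gcongr
  · exact summable_of_ne_finset_zero (s := {0}) fun n hn => by
      simp [show n ≠ 0 by simpa using hn]

/-- The `n`-th Taylor coefficient of `fker` at the origin. -/
def fkerCoeff (n : ℕ) : ℝ := (((1 : ℝ) / 4) ^ n / (n.factorial : ℝ)) ^ 2 * (-1) ^ n

theorem abs_fkerCoeff_le (n : ℕ) : |fkerCoeff n| ≤ 1 / (n.factorial : ℝ) := by
  have hfac : (1 : ℝ) ≤ n.factorial := by exact_mod_cast n.factorial_pos
  have hle : ((1 : ℝ) / 4) ^ n / (n.factorial : ℝ) ≤ 1 / (n.factorial : ℝ) := by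
    gcongr
    exact pow_le_one₀ (by norm_num) (by norm_num)
  have hle_one : 1 / (n.factorial : ℝ) ≤ 1 := by
    rw [div_le_one (by positivity)]
    exact hfac
  have hnonneg : 0 ≤ ((1 : ℝ) / 4) ^ n / (n.factorial : ℝ) := by positivity
  rw [fkerCoeff, abs_mul, abs_pow (-1 : ℝ), abs_neg, abs_one, one_pow, mul_one,
    abs_of_nonneg (by positivity)]
  nlinarith

theorem summable_abs_fkerCoeff_mul_pow (r : ℝ) : Summable fun n => |fkerCoeff n| * r ^ n := by
  refine Summable.of_norm_bounded (Real.summable_pow_div_factorial |r|) fun n => ?_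
  rw [norm_mul, norm_pow, Real.norm_eq_abs, Real.norm_eq_abs, abs_abs]
  calc |fkerCoeff n| * |r| ^ n ≤ 1 / (n.factorial : ℝ) * |r| ^ n := by
        gcongr
        exact abs_fkerCoeff_le n
    _ = |r| ^ n / (n.factorial : ℝ) := by ring

theorem summable_abs_natCast_mul_fkerCoeff_mul_pow (r : ℝ) :
    Summable fun n : ℕ => |n * fkerCoeff n| * r ^ n := by
  refine Summable.of_norm_bounded (summable_abs_fkerCoeff_mul_pow (2 * |r|)) fun n => ?_
  have hn : (n : ℝ) ≤ 2 ^ n := by exact_mod_cast n.lt_two_pow_self.le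
  rw [norm_mul, norm_pow, Real.norm_eq_abs, Real.norm_eq_abs, abs_abs, abs_mul, Nat.abs_cast]
  calc (n : ℝ) * |fkerCoeff n| * |r| ^ n ≤ 2 ^ n * |fkerCoeff n| * |r| ^ n := by gcongr
    _ = |fkerCoeff n| * (2 * |r|) ^ n := by ring

theorem succ_sq_mul_fkerCoeff_succ (n : ℕ) :
    ((n + 1 : ℕ) : ℝ) ^ 2 * fkerCoeff (n + 1) = -((1 : ℝ) / 4) ^ 2 * fkerCoeff n := by
  have hfac : (n.factorial : ℝ) ≠ 0 := by positivity
  have hn : ((n : ℝ) + 1) ≠ 0 := by positivity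
  simp only [fkerCoeff, Nat.factorial_succ, Nat.cast_mul, Nat.cast_add, Nat.cast_one]
  field_simp
  ring

/-- The function `m f'(m)`, where `f` is `fker`. -/
def fkerEuler (m : ℝ) : ℝ := ∑' n : ℕ, n * fkerCoeff n * m ^ n

theorem exists_hasDerivAt_fker (m : ℝ) :
    ∃ f' : ℝ, HasDerivAt fker f' m ∧ m * f' = fkerEuler m := by
  refine ⟨_, hasDerivAt_tsum_mul_pow summable_abs_fkerCoeff_mul_pow m, ?_⟩
  rw [fkerEuler, ← tsum_mul_left]
  refine tsum_congr fun n => ?_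
  cases n with
  | zero => simp
  | succ k =>
    rw [Nat.add_sub_cancel]
    ring

theorem hasDerivAt_fkerEuler (m : ℝ) :
    HasDerivAt fkerEuler (-((1 : ℝ) / 4) ^ 2 * fker m) m := by
  refine (hasDerivAt_tsum_mul_pow summable_abs_natCast_mul_fkerCoeff_mul_pow m).congr_deriv ?_
  rw [fker, ← tsum_mul_left, ← (add_left_injective 1).tsum_eq]
  · refine tsum_congr fun n => ?_
    rw [Nat.add_sub_cancel]
    have h := succ_sq_mul_fkerCoeff_succ n
    rw [fkerCoeff.eq_def n] at h
    linear_combination m ^ n * h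
  · intro n hn
    cases n with
    | zero => simp at hn
    | succ k => exact ⟨k, rfl⟩

theorem continuous_fker : Continuous fker :=
  continuous_iff_continuousAt.2 fun m =>
    let ⟨_, h, _⟩ := exists_hasDerivAt_fker m
    h.continuousAt

/-- Lagrange's identity for the operator `m y'' + y' + A² y` and `fker`. -/
theorem hasDerivAt_fker_lagrange {φ φ' : ℝ → ℝ} {φ'' m : ℝ} (hφ : HasDerivAt φ (φ' m) m)
    (hφ' : HasDerivAt φ' φ'' m) :
    HasDerivAt (fun x => x * fker x * φ' x - fkerEuler x * φ x)
      (fker m * (m * φ'' + φ' m + ((1 : ℝ) / 4) ^ 2 * φ m)) m := by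
  obtain ⟨f', hf, hmf⟩ := exists_hasDerivAt_fker m
  refine ((((hasDerivAt_id' m).fun_mul hf).fun_mul hφ').fun_sub
    ((hasDerivAt_fkerEuler m).fun_mul hφ)).congr_deriv ?_
  linear_combination φ' m * hmf

/-- Lemma 4.1.  With `A = 1/4`, the truncation
`f̄(m) = f(m) 1_{m ≤ 0}` of `f` solves `m y'' + y' + A² y = 0` in the sense of
distributions on `ℝ`: for every test function `φ ∈ C_c^∞(ℝ)`,
`∫ f̄(m) [(m φ(m))'' − φ'(m) + A² φ(m)] dm = 0`. -/
theorem truncated_bessel_solves_ode_distributionally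
    (φ : ℝ → ℝ) (hφ : ContDiff ℝ (⊤ : ℕ∞) φ) (hsupp : HasCompactSupport φ) :
    ∫ m : ℝ, (if m ≤ 0 then fker m else 0) *
      (deriv (deriv (fun m' => m' * φ m')) m - deriv φ m
        + ((1 : ℝ) / 4) ^ 2 * φ m) = 0 := by
  have hφ₀ : Differentiable ℝ φ := hφ.differentiable (by simp)
  have hφ₁ : ContDiff ℝ (⊤ : ℕ∞) (deriv φ) := (contDiff_infty_iff_deriv.1 hφ).2
  have hφ₂ : Differentiable ℝ (deriv φ) := hφ₁.differentiable (by simp)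
  have hφ₃ : Continuous (deriv (deriv φ)) := hφ₁.continuous_deriv (by simp)
  have hmul : deriv (fun x => x * φ x) = fun x => φ x + x * deriv φ x := by
    funext x
    simpa using ((hasDerivAt_id' x).fun_mul (hφ₀ x).hasDerivAt).deriv
  have hmul₂ (x : ℝ) :
      deriv (deriv fun y => y * φ y) x = 2 * deriv φ x + x * deriv (deriv φ) x := by
    rw [hmul]
    refine (((hφ₀ x).hasDerivAt.add
      ((hasDerivAt_id' x).mul (hφ₂ x).hasDerivAt)).deriv).trans ?_
    ring
  set G : ℝ → ℝ := fun x => x * fker x * deriv φ x - fkerEuler x * φ x with hG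
  have hG' (x : ℝ) := hasDerivAt_fker_lagrange (hφ₀ x).hasDerivAt (hφ₂ x).hasDerivAt
  have hderiv : deriv G = fun x =>
      fker x * (x * deriv (deriv φ) x + deriv φ x + ((1 : ℝ) / 4) ^ 2 * φ x) :=
    funext fun x => (hG' x).deriv
  have hGsmooth : ContDiff ℝ 1 G := by
    refine contDiff_one_iff_deriv.2 ⟨fun x => (hG' x).differentiableAt, ?_⟩
    rw [hderiv]
    exact continuous_fker.mul (((continuous_id.mul hφ₃).add hφ₁.continuous).add
      (continuous_const.mul hφ.continuous))
  have hGsupp : HasCompactSupport G := hsupp.deriv.mul_left.sub hsupp.mul_left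
  have hG₀ : G 0 = 0 := by
    obtain ⟨f', -, h⟩ := exists_hasDerivAt_fker 0
    simp [hG, ← h]
  have hint := hGsupp.integral_Iic_deriv_eq hGsmooth 0
  rw [hG₀, ← integral_indicator measurableSet_Iic, hderiv] at hint
  refine Eq.trans (integral_congr_ae (.of_forall fun x => ?_)) hint
  by_cases hx : x ≤ 0
  · simp only [hx, if_true, indicator_of_mem (mem_Iic.2 hx), hmul₂]
    ring
  · simp [hx]
end
end

section
/- Let A = 1/4, f(m) = Σ_{n≥0} (A^n/n!)² (−1)^n m^n, and define the entropy kernel χ(R,u) := e^{R/2} f(u² − R²) if u² ≤ R² and χ(R,u) := 0 otherwise. Then χ is a fundamental solution of the entropy wave equation η_RR − η_uu − η_R = 0 with a Dirac source of mass 4 at the origin: for every test function φ ∈ C_c^∞(ℝ²), ∬_{ℝ²} χ(R,u) ( ∂_RR φ(R,u) − ∂_uu φ(R,u) + ∂_R φ(R,u) ) dR du = 4 φ(0,0). -/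
open MeasureTheory Real Set Filter Topology

noncomputable section

/-- A power series with coefficients bounded by those of `exp` converges everywhere. -/
theorem summable_mul_pow_of_abs_le_inv_factorial {c : ℕ → ℝ}
    (hc : ∀ n, |c n| ≤ 1 / (n.factorial : ℝ)) (x : ℝ) : Summable fun n => c n * x ^ n := by
  refine Summable.of_norm_bounded (Real.summable_pow_div_factorial |x|) fun n => ?_
  rw [norm_mul, norm_pow, Real.norm_eq_abs, Real.norm_eq_abs, div_eq_inv_mul, ← one_div]
  gcongr
  exact hc n

/-- A power series with coefficients bounded by those of `exp` can be differentiated termwise. -/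
theorem hasDerivAt_tsum_mul_pow_of_abs_le_inv_factorial {c : ℕ → ℝ}
    (hc : ∀ n, |c n| ≤ 1 / (n.factorial : ℝ)) (x : ℝ) :
    HasDerivAt (fun y => ∑' n, c n * y ^ n) (∑' n : ℕ, ((n : ℝ) + 1) * c (n + 1) * x ^ n) x := by
  set r : ℝ := |x| + 1
  have hr : 0 ≤ r := by positivity
  have hbound : Summable fun n : ℕ => (n : ℝ) / n.factorial * r ^ (n - 1) := by
    rw [← summable_nat_add_iff 1]
    refine (Real.summable_pow_div_factorial r).congr fun n => ?_
    rw [Nat.factorial_succ]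
    push_cast
    field_simp
  have hterm : ∀ (n : ℕ) (y : ℝ), y ∈ Metric.ball (0 : ℝ) r →
      ‖c n * ((n : ℝ) * y ^ (n - 1))‖ ≤ (n : ℝ) / n.factorial * r ^ (n - 1) := by
    intro n y hy
    have hy' : |y| ≤ r := by simpa using (Metric.mem_ball.1 hy).le
    rw [norm_mul, norm_mul, norm_pow, Real.norm_eq_abs, Real.norm_eq_abs, Real.norm_eq_abs,
      Nat.abs_cast]
    calc |c n| * (n * |y| ^ (n - 1)) ≤ 1 / (n.factorial : ℝ) * (n * r ^ (n - 1)) := by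
          gcongr
          exact hc n
      _ = _ := by ring
  have hx : x ∈ Metric.ball (0 : ℝ) r := by simp [r]
  have h := hasDerivAt_tsum_of_isPreconnected (g := fun n y => c n * y ^ n)
    (g' := fun n y => c n * ((n : ℝ) * y ^ (n - 1))) hbound Metric.isOpen_ball
    (convex_ball (0 : ℝ) r).isPreconnected (fun n y _ => (hasDerivAt_pow n y).const_mul (c n))
    hterm hx (summable_mul_pow_of_abs_le_inv_factorial hc x) hx
  refine h.congr_deriv ?_
  have hs : Summable fun n : ℕ => c n * ((n : ℝ) * x ^ (n - 1)) :=
    Summable.of_norm_bounded hbound fun n => hterm n x hx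
  rw [hs.tsum_eq_zero_add]
  simp only [Nat.cast_zero, zero_mul, mul_zero, zero_add, Nat.add_sub_cancel]
  refine tsum_congr fun n => ?_
  push_cast
  ring

theorem abs_quarter_pow_div_factorial_mul_le (n k : ℕ) :
    |((1 : ℝ) / 4) ^ k / ((n.factorial : ℝ) * k.factorial)| ≤ 1 / (n.factorial : ℝ) := by
  rw [abs_of_nonneg (by positivity)]
  have h1 : ((1 : ℝ) / 4) ^ k ≤ 1 := pow_le_one₀ (by norm_num) (by norm_num)
  have h2 : (1 : ℝ) ≤ k.factorial := by exact_mod_cast Nat.one_le_iff_ne_zero.2 k.factorial_ne_zero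
  have h3 : (0 : ℝ) < n.factorial := by positivity
  exact div_le_div₀ zero_le_one h1 h3 (le_mul_of_one_le_right h3.le h2)

/-- The profile `t ↦ f(-4t)` of the kernel solves `t F'' + F' = F / 4` with `F 0 = 1`. -/
theorem exists_fker_ode : ∃ F₁ F₂ : ℝ → ℝ,
    (∀ t, HasDerivAt (fun t => fker (-4 * t)) (F₁ t) t) ∧ (∀ t, HasDerivAt F₁ (F₂ t) t) ∧
    (∀ t, t * F₂ t + F₁ t = fker (-4 * t) / 4) ∧ fker 0 = 1 := by
  have hF : (fun t => fker (-4 * t)) =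
      fun t => ∑' n : ℕ, ((1 : ℝ) / 4) ^ n / ((n.factorial : ℝ) * n.factorial) * t ^ n := by
    funext t
    refine tsum_congr fun n => ?_
    have h : ((1 : ℝ) / 4) ^ n * ((1 : ℝ) / 4) ^ n * ((-1) ^ n * (-4) ^ n) = (1 / 4) ^ n := by
      simp only [← mul_pow]
      norm_num
    calc _ = ((1 : ℝ) / 4) ^ n * ((1 : ℝ) / 4) ^ n * ((-1) ^ n * (-4) ^ n) /
          ((n.factorial : ℝ) * n.factorial) * t ^ n := by rw [mul_pow]; ring
      _ = _ := by rw [h]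
  set d : ℕ → ℝ := fun n => ((1 : ℝ) / 4) ^ (n + 1) / ((n.factorial : ℝ) * (n + 1).factorial)
    with hd
  have hcd : ∀ n : ℕ, ((n : ℝ) + 1) *
      (((1 : ℝ) / 4) ^ (n + 1) / (((n + 1).factorial : ℝ) * (n + 1).factorial)) = d n := by
    intro n
    simp only [hd, Nat.factorial_succ]
    push_cast
    field_simp
  have hdb : ∀ n, |d n| ≤ 1 / (n.factorial : ℝ) :=
    fun n => abs_quarter_pow_div_factorial_mul_le n (n + 1)
  have hd'b : ∀ n : ℕ, |((n : ℝ) + 1) * d (n + 1)| ≤ 1 / (n.factorial : ℝ) := by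
    intro n
    convert abs_quarter_pow_div_factorial_mul_le n (n + 2) using 2
    simp only [hd, Nat.factorial_succ n]
    push_cast
    field_simp
  refine ⟨fun t => ∑' n, d n * t ^ n, fun t => ∑' n : ℕ, ((n : ℝ) + 1) * d (n + 1) * t ^ n,
    fun t => ?_, hasDerivAt_tsum_mul_pow_of_abs_le_inv_factorial hdb, fun t => ?_, ?_⟩
  · rw [hF]
    simpa only [hcd] using hasDerivAt_tsum_mul_pow_of_abs_le_inv_factorial
      (fun n => abs_quarter_pow_div_factorial_mul_le n n) t
  · have hs₁ := summable_mul_pow_of_abs_le_inv_factorial hdb t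
    have hs₂ := (summable_mul_pow_of_abs_le_inv_factorial hd'b t).mul_left t
    have hs₃ : Summable fun n : ℕ => (n : ℝ) * d n * t ^ n := by
      rw [← summable_nat_add_iff 1]
      refine hs₂.congr fun n => ?_
      push_cast
      ring
    have hshift : t * ∑' n : ℕ, ((n : ℝ) + 1) * d (n + 1) * t ^ n =
        ∑' n : ℕ, (n : ℝ) * d n * t ^ n := by
      rw [hs₃.tsum_eq_zero_add, ← tsum_mul_left]
      simp only [Nat.cast_zero, zero_mul, zero_add]
      refine tsum_congr fun n => ?_
      push_cast
      ring
    rw [hshift, ← hs₃.tsum_add hs₁, congrFun hF t, ← tsum_div_const]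
    refine tsum_congr fun n => ?_
    simp only [hd, Nat.factorial_succ]
    push_cast
    field_simp
    ring
  · rw [fker, tsum_eq_single 0 fun n hn => by simp [hn]]
    simp

/-- Green's formula on the square between `0` and `(M, M)` for the equation
`∂ₐ ∂_b w = w / 4`, applied to `w(a, b) = F(a b)`. -/
theorem integral_square_mul_sub_eq {F F₁ F₂ : ℝ → ℝ} (hF : ∀ t, HasDerivAt F (F₁ t) t)
    (hF₁ : ∀ t, HasDerivAt F₁ (F₂ t) t) (hode : ∀ t, t * F₂ t + F₁ t = F t / 4)
    (hF0 : F 0 = 1) {g ga gab : ℝ × ℝ → ℝ} (hg : Continuous g) (hga : Continuous ga)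
    (hgab : Continuous gab)
    (hda : ∀ a b, HasDerivAt (fun s => g (s, b)) (ga (a, b)) a)
    (hdb : ∀ a b, HasDerivAt (fun s => ga (a, s)) (gab (a, b)) b) {M : ℝ}
    (hM₁ : ∀ b, g (M, b) = 0) (hM₂ : ∀ a, ga (a, M) = 0) :
    ∫ a in (0 : ℝ)..M, ∫ b in (0 : ℝ)..M, F (a * b) * (gab (a, b) - g (a, b) / 4) = g (0, 0) := by
  have hFc : Continuous F := continuous_iff_continuousAt.2 fun t => (hF t).continuousAt
  have hF₁c : Continuous F₁ := continuous_iff_continuousAt.2 fun t => (hF₁ t).continuousAt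
  set Pb : ℝ → ℝ → ℝ := fun a b => a * F₁ (a * b) * ga (a, b) + F (a * b) * gab (a, b) with hPb
  set Qa : ℝ → ℝ → ℝ := fun a b => F (a * b) / 4 * g (a, b) + a * F₁ (a * b) * ga (a, b) with hQa
  have hPc : Continuous (Function.uncurry Pb) := by
    simp only [hPb, Function.uncurry_def]; fun_prop
  have hQc : Continuous (Function.uncurry Qa) := by
    simp only [hQa, Function.uncurry_def]; fun_prop
  have hPint : ∀ a, ∫ b in (0 : ℝ)..M, Pb a b = - ga (a, 0) := by
    intro a
    rw [intervalIntegral.integral_eq_sub_of_hasDerivAt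
      (f := fun b => F (a * b) * ga (a, b)) (fun b _ => ?_)
      (Continuous.intervalIntegrable (by simp only [hPb]; fun_prop) _ _)]
    · simp [hM₂, hF0]
    · have h1 : HasDerivAt (fun b => F (a * b)) (F₁ (a * b) * a) b := by
        exact ((hF (a * b)).comp b ((hasDerivAt_id' b).const_mul a)).congr_deriv (by simp)
      refine (h1.mul (hdb a b)).congr_deriv ?_
      simp only [hPb]; ring
  have hQint : ∀ b, ∫ a in (0 : ℝ)..M, Qa a b = 0 := by
    intro b
    rw [intervalIntegral.integral_eq_sub_of_hasDerivAt
      (f := fun a => a * F₁ (a * b) * g (a, b)) (fun a _ => ?_)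
      (Continuous.intervalIntegrable (by simp only [hQa]; fun_prop) _ _)]
    · simp [hM₁]
    · have h1 : HasDerivAt (fun a => F₁ (a * b)) (F₂ (a * b) * b) a := by
        exact ((hF₁ (a * b)).comp a ((hasDerivAt_id' a).mul_const b)).congr_deriv (by simp)
      refine (((hasDerivAt_id' a).mul h1).mul (hda a b)).congr_deriv ?_
      simp only [hQa, ← hode (a * b), Pi.mul_apply]; ring
  have hsub : ∀ a, ∫ b in (0 : ℝ)..M, F (a * b) * (gab (a, b) - g (a, b) / 4) =
      (∫ b in (0 : ℝ)..M, Pb a b) - ∫ b in (0 : ℝ)..M, Qa a b := by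
    intro a
    rw [← intervalIntegral.integral_sub
      (Continuous.intervalIntegrable (by simp only [hPb]; fun_prop) _ _)
      (Continuous.intervalIntegrable (by simp only [hQa]; fun_prop) _ _)]
    refine intervalIntegral.integral_congr fun b _ => ?_
    simp only [hPb, hQa]; ring
  have hQiter : ∫ a in (0 : ℝ)..M, ∫ b in (0 : ℝ)..M, Qa a b = 0 := by
    rw [intervalIntegral_intervalIntegral_swap]
    · simp [hQint]
    · refine (hQc.continuousOn.integrableOn_compact
        (isCompact_uIcc.prod isCompact_uIcc)).mono_set
        (prod_mono (uIoc_subset_uIcc (a := 0) (b := M)) (uIoc_subset_uIcc (a := 0) (b := M)))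
  simp only [hsub]
  rw [intervalIntegral.integral_sub, hQiter]
  · simp only [hPint]
    rw [intervalIntegral.integral_neg, intervalIntegral.integral_eq_sub_of_hasDerivAt
      (fun a _ => hda a 0) (Continuous.intervalIntegrable (by fun_prop) _ _), hM₁]
    ring
  · simp only [hPint]
    exact Continuous.intervalIntegrable (by fun_prop) _ _
  · exact (intervalIntegral.continuous_parametric_intervalIntegral_of_continuous'
      hQc _ _).intervalIntegrable _ _

/-- Change of variables to the characteristic coordinates `R = a + b`, `u = a - b`. -/
theorem integral_comp_add_sub (h : ℝ × ℝ → ℝ) :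
    ∫ p, h p = ∫ q : ℝ × ℝ, 2 * h (q.1 + q.2, q.1 - q.2) := by
  set T : ℝ × ℝ →L[ℝ] ℝ × ℝ := (Matrix.toLin (.finTwoProd ℝ) (.finTwoProd ℝ)
    !![1, 1; 1, -1]).toContinuousLinearMap with hT
  have hTapply : ∀ q, T q = (q.1 + q.2, q.1 - q.2) := by
    intro q
    rw [hT, Matrix.toLin_finTwoProd_toContinuousLinearMap]
    simp [sub_eq_add_neg]
  have hdet : T.det = -2 := by
    simp only [hT, LinearMap.det_toContinuousLinearMap, LinearMap.det_toLin,
      Matrix.det_fin_two_of]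
    norm_num
  have hinj : InjOn T univ := by
    intro p _ q _ hpq
    simp only [hTapply, Prod.mk.injEq] at hpq
    ext <;> linarith [hpq.1, hpq.2]
  have himage : T '' univ = univ := by
    refine eq_univ_of_forall fun p => ⟨((p.1 + p.2) / 2, (p.1 - p.2) / 2), mem_univ _, ?_⟩
    rw [hTapply]
    ext <;> simp <;> ring
  have := integral_image_eq_integral_abs_det_fderiv_smul volume MeasurableSet.univ
    (fun x _ => T.hasFDerivAt.hasFDerivWithinAt) hinj h
  rw [himage] at this
  simpa [hdet, hTapply] using this

/-- The integral over the double quadrant `0 ≤ a b` of a function supported in the square of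
radius `M`, as a sum of two iterated integrals. -/
theorem integral_indicator_mul_nonneg {H : ℝ × ℝ → ℝ} (hH : Continuous H) {M : ℝ} (hM : 0 ≤ M)
    (hvanish : ∀ p : ℝ × ℝ, M ≤ |p.1| ∨ M ≤ |p.2| → H p = 0) :
    ∫ p : ℝ × ℝ, (if 0 ≤ p.1 * p.2 then H p else 0) =
      (∫ a in (0 : ℝ)..M, ∫ b in (0 : ℝ)..M, H (a, b)) +
        ∫ a in (0 : ℝ)..(-M), ∫ b in (0 : ℝ)..(-M), H (a, b) := by
  have hint : ∀ a b c d : ℝ, IntegrableOn H (Ioc a b ×ˢ Ioc c d) := fun a b c d =>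
    (hH.continuousOn.integrableOn_compact (isCompact_Icc.prod isCompact_Icc)).mono_set
      (prod_mono Ioc_subset_Icc_self Ioc_subset_Icc_self)
  have hms : ∀ a b c d : ℝ, MeasurableSet (Ioc a b ×ˢ Ioc c d) := fun a b c d =>
    measurableSet_Ioc.prod measurableSet_Ioc
  have hiter : ∀ a b : ℝ, a ≤ b → ∫ p in Ioc a b ×ˢ Ioc a b, H p =
      ∫ x in a..b, ∫ y in a..b, H (x, y) := by
    intro a b hab
    simp only [intervalIntegral.integral_of_le hab]
    exact setIntegral_prod H (hint a b a b)
  have hfst : ∀ᵐ p : ℝ × ℝ, p.1 ≠ 0 :=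
    Measure.quasiMeasurePreserving_fst.ae (Measure.ae_ne volume (0 : ℝ))
  have hsnd : ∀ᵐ p : ℝ × ℝ, p.2 ≠ 0 :=
    Measure.quasiMeasurePreserving_snd.ae (Measure.ae_ne volume (0 : ℝ))
  have hae : (fun p : ℝ × ℝ => if 0 ≤ p.1 * p.2 then H p else 0) =ᵐ[volume] fun p =>
      (Ioc 0 M ×ˢ Ioc 0 M).indicator H p + (Ioc (-M) 0 ×ˢ Ioc (-M) 0).indicator H p := by
    filter_upwards [hfst, hsnd] with p h1 h2
    by_cases hout : M ≤ |p.1| ∨ M ≤ |p.2|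
    · simp [hvanish p hout, indicator]
    push Not at hout
    obtain ⟨⟨h3, h4⟩, h5, h6⟩ := hout.imp abs_lt.1 abs_lt.1
    simp only [indicator, mem_prod, mem_Ioc]
    rcases lt_or_gt_of_ne h1 with h1 | h1 <;> rcases lt_or_gt_of_ne h2 with h2 | h2
    · simp [(mul_pos_of_neg_of_neg h1 h2).le, h1.le, h2.le, h1.not_gt, h3, h5]
    · simp [(mul_neg_of_neg_of_pos h1 h2).not_ge, h1.not_gt, h2.not_ge]
    · simp [(mul_neg_of_pos_of_neg h1 h2).not_ge, h2.not_gt, h1.not_ge]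
    · simp [(mul_pos h1 h2).le, h1, h2, h1.not_ge, h4.le, h6.le]
  rw [integral_congr_ae hae, integral_add ((hint _ _ _ _).integrable_indicator (hms _ _ _ _))
    ((hint _ _ _ _).integrable_indicator (hms _ _ _ _)), integral_indicator (hms _ _ _ _),
    integral_indicator (hms _ _ _ _), hiter _ _ hM, hiter _ _ (neg_nonpos.2 hM)]
  simp only [intervalIntegral.integral_symm (-M) 0, intervalIntegral.integral_neg, neg_neg]

theorem chiKer_add_sub (a b : ℝ) : chiKer (a + b) (a - b) =
    if 0 ≤ a * b then Real.exp ((a + b) / 2) * fker (-4 * (a * b)) else 0 := by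
  have h1 : (a - b) ^ 2 ≤ (a + b) ^ 2 ↔ 0 ≤ a * b := by
    constructor <;> intro h <;> nlinarith
  have h2 : (a - b) ^ 2 - (a + b) ^ 2 = -4 * (a * b) := by ring
  simp only [chiKer, h1, h2]

section Lines

variable {ψ : ℝ × ℝ → ℝ}

theorem hasDerivAt_fst_line (hψ : Differentiable ℝ ψ) (x y : ℝ) :
    HasDerivAt (fun s => ψ (s, y)) (fderiv ℝ ψ (x, y) (1, 0)) x :=
  (hψ (x, y)).hasFDerivAt.comp_hasDerivAt x ((hasDerivAt_id' x).prodMk (hasDerivAt_const x y))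

theorem hasDerivAt_snd_line (hψ : Differentiable ℝ ψ) (x y : ℝ) :
    HasDerivAt (fun s => ψ (x, s)) (fderiv ℝ ψ (x, y) (0, 1)) y :=
  (hψ (x, y)).hasFDerivAt.comp_hasDerivAt y ((hasDerivAt_const y x).prodMk (hasDerivAt_id' y))

theorem hasDerivAt_diagonal_line (hψ : Differentiable ℝ ψ) (a b : ℝ) :
    HasDerivAt (fun s => ψ (s + b, s - b))
      (fderiv ℝ ψ (a + b, a - b) (1, 0) + fderiv ℝ ψ (a + b, a - b) (0, 1)) a := by
  rw [← map_add]
  exact ((hψ (a + b, a - b)).hasFDerivAt.comp_hasDerivAt a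
    (((hasDerivAt_id' a).add_const b).prodMk ((hasDerivAt_id' a).sub_const b))).congr_deriv
      (by simp)

theorem hasDerivAt_antidiagonal_line (hψ : Differentiable ℝ ψ) (a b : ℝ) :
    HasDerivAt (fun s => ψ (a + s, a - s))
      (fderiv ℝ ψ (a + b, a - b) (1, 0) - fderiv ℝ ψ (a + b, a - b) (0, 1)) b := by
  rw [← map_sub]
  exact ((hψ (a + b, a - b)).hasFDerivAt.comp_hasDerivAt b
    (((hasDerivAt_id' b).const_add a).prodMk ((hasDerivAt_id' b).const_sub a))).congr_deriv
      (by simp)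

theorem contDiff_fderiv_apply_top (hψ : ContDiff ℝ (⊤ : ℕ∞) ψ) (v : ℝ × ℝ) :
    ContDiff ℝ (⊤ : ℕ∞) fun p => fderiv ℝ ψ p v :=
  (hψ.fderiv_right (m := (⊤ : ℕ∞)) (by simp)).clm_apply contDiff_const

theorem fderiv_fderiv_apply_comm (hψ : ContDiff ℝ (⊤ : ℕ∞) ψ) (v w p : ℝ × ℝ) :
    fderiv ℝ (fun q => fderiv ℝ ψ q v) p w = fderiv ℝ (fun q => fderiv ℝ ψ q w) p v := by
  have hd : DifferentiableAt ℝ (fderiv ℝ ψ) p :=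
    ((hψ.fderiv_right (m := (⊤ : ℕ∞)) (by simp)).differentiable (by simp)) p
  have hsymm : IsSymmSndFDerivAt ℝ ψ p :=
    (contDiff_infty.1 hψ 2).contDiffAt.isSymmSndFDerivAt (by simp)
  rw [fderiv_clm_apply hd (differentiableAt_const v),
    fderiv_clm_apply hd (differentiableAt_const w)]
  simpa using hsymm w v

end Lines

theorem HasCompactSupport.exists_forall_notMem_tsupport {φ : ℝ × ℝ → ℝ}
    (hsupp : HasCompactSupport φ) : ∃ M : ℝ, 0 < M ∧
      ∀ a b : ℝ, M ≤ |a| ∨ M ≤ |b| → (a + b, a - b) ∉ tsupport φ := by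
  obtain ⟨r, hr⟩ := (HasCompactSupport.isCompact hsupp).isBounded.subset_closedBall (0 : ℝ × ℝ)
  refine ⟨|r| + 1, by positivity, fun a b hab hmem => ?_⟩
  have h := hr hmem
  rw [mem_closedBall_zero_iff, Prod.norm_def, max_le_iff, Real.norm_eq_abs, Real.norm_eq_abs,
    abs_le, abs_le] at h
  have hr' := le_abs_self r
  rcases hab with hab | hab
  · exact absurd hab (not_le.2 (abs_lt.2 ⟨by linarith [h.1.1, h.2.1], by linarith [h.1.2, h.2.2]⟩))
  · exact absurd hab (not_le.2 (abs_lt.2 ⟨by linarith [h.1.1, h.2.2], by linarith [h.1.2, h.2.1]⟩))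

/-- Theorem 4.2: existence of the entropy kernel.  The kernel
`χ(R,u) = e^{R/2} f(u² − R²) 1_{u² ≤ R²}` is a fundamental solution of the
entropy wave equation `η_RR − η_uu − η_R = 0` with Dirac source of mass `4` at
the origin: for every `φ ∈ C_c^∞(ℝ²)` (first variable `R`, second `u`),
`∬ χ (∂_RR φ − ∂_uu φ + ∂_R φ) = 4 φ(0,0)`. -/
theorem chi_fundamental_solution
    (φ : ℝ × ℝ → ℝ) (hφ : ContDiff ℝ (⊤ : ℕ∞) φ) (hsupp : HasCompactSupport φ) :
    ∫ p : ℝ × ℝ, chiKer p.1 p.2 *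
      (deriv (fun R => deriv (fun R' => φ (R', p.2)) R) p.1
        - deriv (fun u => deriv (fun u' => φ (p.1, u')) u) p.2
        + deriv (fun R => φ (R, p.2)) p.1)
      = 4 * φ (0, 0) := by
  obtain ⟨F₁, F₂, hF, hF₁, hode, hF0⟩ := exists_fker_ode
  obtain ⟨M, hM, hMsupp⟩ := hsupp.exists_forall_notMem_tsupport
  set φR : ℝ × ℝ → ℝ := fun p => fderiv ℝ φ p (1, 0) with hφR
  set φu : ℝ × ℝ → ℝ := fun p => fderiv ℝ φ p (0, 1) with hφu
  set φRR : ℝ × ℝ → ℝ := fun p => fderiv ℝ φR p (1, 0) with hφRR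
  set φuu : ℝ × ℝ → ℝ := fun p => fderiv ℝ φu p (0, 1) with hφuu
  have hφRs : ContDiff ℝ (⊤ : ℕ∞) φR := contDiff_fderiv_apply_top hφ _
  have hφus : ContDiff ℝ (⊤ : ℕ∞) φu := contDiff_fderiv_apply_top hφ _
  have hφc := hφ.continuous
  have hφRc := hφRs.continuous
  have hφuc := hφus.continuous
  have hφRRc : Continuous φRR := (contDiff_fderiv_apply_top hφRs _).continuous
  have hφuuc : Continuous φuu := (contDiff_fderiv_apply_top hφus _).continuous
  have hφd : Differentiable ℝ φ := hφ.differentiable (by simp)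
  have hφRd : Differentiable ℝ φR := hφRs.differentiable (by simp)
  have hφud : Differentiable ℝ φu := hφus.differentiable (by simp)
  have hR : ∀ R u, deriv (fun s => φ (s, u)) R = φR (R, u) := fun R u =>
    (hasDerivAt_fst_line hφd R u).deriv
  have hu : ∀ R u, deriv (fun s => φ (R, s)) u = φu (R, u) := fun R u =>
    (hasDerivAt_snd_line hφd R u).deriv
  have hRR : ∀ R u, deriv (fun s => φR (s, u)) R = φRR (R, u) := fun R u =>
    (hasDerivAt_fst_line hφRd R u).deriv
  have huu : ∀ R u, deriv (fun s => φu (R, s)) u = φuu (R, u) := fun R u =>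
    (hasDerivAt_snd_line hφud R u).deriv
  have hmixed : ∀ p, fderiv ℝ φu p (1, 0) = fderiv ℝ φR p (0, 1) := fun p =>
    fderiv_fderiv_apply_comm hφ _ _ p
  have hRsub : tsupport φR ⊆ tsupport φ := tsupport_fderiv_apply_subset ℝ _
  have husub : tsupport φu ⊆ tsupport φ := tsupport_fderiv_apply_subset ℝ _
  have hRRsub : tsupport φRR ⊆ tsupport φ := (tsupport_fderiv_apply_subset ℝ _).trans hRsub
  have huusub : tsupport φuu ⊆ tsupport φ := (tsupport_fderiv_apply_subset ℝ _).trans husub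
  simp only [hR, hu, hRR, huu]
  -- `g` and its derivatives in the characteristic coordinates `R = a + b`, `u = a - b`
  set g : ℝ × ℝ → ℝ := fun q => Real.exp ((q.1 + q.2) / 2) * φ (q.1 + q.2, q.1 - q.2) with hg
  set ga : ℝ × ℝ → ℝ := fun q => Real.exp ((q.1 + q.2) / 2) *
    (φ (q.1 + q.2, q.1 - q.2) / 2 + φR (q.1 + q.2, q.1 - q.2) + φu (q.1 + q.2, q.1 - q.2)) with hga
  set gab : ℝ × ℝ → ℝ := fun q => Real.exp ((q.1 + q.2) / 2) *
    (φRR (q.1 + q.2, q.1 - q.2) - φuu (q.1 + q.2, q.1 - q.2) + φR (q.1 + q.2, q.1 - q.2) +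
      φ (q.1 + q.2, q.1 - q.2) / 4) with hgab
  have hgc : Continuous g := by fun_prop
  have hgac : Continuous ga := by fun_prop
  have hgabc : Continuous gab := by fun_prop
  have hgv : ∀ q : ℝ × ℝ, M ≤ |q.1| ∨ M ≤ |q.2| → g q = 0 ∧ ga q = 0 ∧ gab q = 0 := by
    intro q hq
    have hq' := hMsupp q.1 q.2 hq
    have h0 := image_eq_zero_of_notMem_tsupport hq'
    have h1 := image_eq_zero_of_notMem_tsupport fun h => hq' (hRsub h)
    have h2 := image_eq_zero_of_notMem_tsupport fun h => hq' (husub h)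
    have h3 := image_eq_zero_of_notMem_tsupport fun h => hq' (hRRsub h)
    have h4 := image_eq_zero_of_notMem_tsupport fun h => hq' (huusub h)
    simp only [hg, hga, hgab, h0, h1, h2, h3, h4]
    simp
  have hda : ∀ a b, HasDerivAt (fun s => g (s, b)) (ga (a, b)) a := by
    intro a b
    have he := (((hasDerivAt_id' a).add_const b).div_const 2).exp
    refine (he.mul (hasDerivAt_diagonal_line hφd a b)).congr_deriv ?_
    simp only [hga, hφR, hφu]
    ring
  have hdb : ∀ a b, HasDerivAt (fun s => ga (a, s)) (gab (a, b)) b := by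
    intro a b
    have he := (((hasDerivAt_id' b).const_add a).div_const 2).exp
    refine (he.mul ((((hasDerivAt_antidiagonal_line hφd a b).div_const 2).add
      (hasDerivAt_antidiagonal_line hφRd a b)).add
      (hasDerivAt_antidiagonal_line hφud a b))).congr_deriv ?_
    simp only [hgab, hφRR, hφuu, hmixed, Pi.add_apply]
    simp only [hφR, hφu]
    ring
  have hFc : Continuous fun t => fker (-4 * t) :=
    continuous_iff_continuousAt.2 fun t => (hF t).continuousAt
  have hHc : Continuous fun q : ℝ × ℝ => fker (-4 * (q.1 * q.2)) * (gab q - g q / 4) :=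
    (hFc.comp (by fun_prop : Continuous fun q : ℝ × ℝ => q.1 * q.2)).mul (by fun_prop)
  have hsquare : ∀ N : ℝ, M ≤ |N| → ∫ a in (0 : ℝ)..N, ∫ b in (0 : ℝ)..N,
      fker (-4 * (a * b)) * (gab (a, b) - g (a, b) / 4) = φ (0, 0) := by
    intro N hN
    rw [integral_square_mul_sub_eq hF hF₁ hode (by simpa using hF0) hgc hgac hgabc hda hdb
      (fun b => (hgv (N, b) (.inl hN)).1) (fun a => (hgv (a, N) (.inr hN)).2.1)]
    simp [hg]
  rw [integral_comp_add_sub]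
  have hcongr : ∀ q : ℝ × ℝ, 2 * (chiKer (q.1 + q.2) (q.1 - q.2) *
      (φRR (q.1 + q.2, q.1 - q.2) - φuu (q.1 + q.2, q.1 - q.2) + φR (q.1 + q.2, q.1 - q.2))) =
      2 * if 0 ≤ q.1 * q.2 then fker (-4 * (q.1 * q.2)) * (gab q - g q / 4) else 0 := by
    intro q
    rw [chiKer_add_sub]
    split_ifs
    · simp only [hg, hgab]; ring
    · simp
  simp only [hcongr]
  rw [integral_const_mul, integral_indicator_mul_nonneg hHc hM.le fun q hq => by
    simp [hgv q hq], hsquare M (le_abs_self M), hsquare (-M) (by rw [abs_neg]; exact le_abs_self M)]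
  ring
end
end

section
/- Let A = 1/4, f(m) = Σ_{n≥0} (A^n/n!)² (−1)^n m^n, and χ(R,u) := e^{R/2} f(u² − R²) · 1_{u² ≤ R²}. Then: (i) χ(R,u) = 0 whenever |u| > |R|; (ii) for every fixed u ∈ ℝ, χ(R,u) → 0 as R → −∞; (iii) for every φ ∈ C_c^∞(ℝ), ∫_ℝ χ(R,u) φ(u) du → 0 as R → 0; and (iv) for every φ ∈ C_c^∞(ℝ), the function R ↦ ∫_ℝ χ(R,u) φ(u) du is differentiable for R ≠ 0 and its derivative tends to +2 φ(0) as R → 0+, and to −2 φ(0) as R → 0−; moreover for R ≠ 0 this derivative equals ∫_{|u|<|R|} φ(u) e^{R/2} ( f(u²−R²)/2 − 2R f'(u²−R²) ) du + e^{R/2} (φ(R) + φ(−R)) (1_{R>0} − 1_{R<0}). -/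
open MeasureTheory Real Set Filter Topology

noncomputable section

/-- The Leibniz rule for `x ↦ ∫ t in 0..s x, g x t`, where `g` and its derivative in the parameter
are jointly continuous. -/
theorem hasDerivAt_integral_zero_variable {g g' : ℝ → ℝ → ℝ}
    (hg : Continuous (Function.uncurry g)) (hg' : Continuous (Function.uncurry g'))
    (hd : ∀ x t, HasDerivAt (fun y => g y t) (g' x t) x)
    {s : ℝ → ℝ} {s' x : ℝ} (hs : HasDerivAt s s' x) :
    HasDerivAt (fun y => ∫ t in (0 : ℝ)..s y, g y t)
      ((∫ t in (0 : ℝ)..s x, g' x t) + s' * g x (s x)) x := by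
  have hcx (y : ℝ) : Continuous (g y) := hg.uncurry_left y
  have hcx' (y : ℝ) : Continuous (g' y) := hg'.uncurry_left y
  have hparam (b y : ℝ) :
      HasDerivAt (fun z => ∫ t in (0 : ℝ)..b, g z t) (∫ t in (0 : ℝ)..b, g' y t) y := by
    obtain ⟨C, hC⟩ := ((isCompact_closedBall y 1).prod
      (isCompact_uIcc (a := (0 : ℝ)) (b := b))).exists_bound_of_continuousOn hg'.continuousOn
    refine (intervalIntegral.hasDerivAt_integral_of_dominated_loc_of_deriv_le
      (s := Metric.closedBall y 1) (bound := fun _ => C) (F := g) (F' := g')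
      (Metric.closedBall_mem_nhds y one_pos)
      (.of_forall fun z => (hcx z).aestronglyMeasurable)
      ((hcx y).intervalIntegrable _ _) (hcx' y).aestronglyMeasurable
      (.of_forall fun t ht z hz => hC (z, t) ⟨hz, uIoc_subset_uIcc ht⟩)
      (intervalIntegrable_const) (.of_forall fun t _ z _ => hd z t)).2
  have hprim (y b : ℝ) : HasDerivAt (fun b => ∫ t in (0 : ℝ)..b, g y t) (g y b) b :=
    intervalIntegral.integral_hasDerivAt_right ((hcx y).intervalIntegrable _ _)
      ((hcx y).stronglyMeasurableAtFilter _ _) (hcx y).continuousAt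
  have hP := hasStrictFDerivAt_uncurry_coprod (𝕜 := ℝ) (u := (x, s x))
    (f := fun y b => ∫ t in (0 : ℝ)..b, g y t)
    (f₁ := fun y b => ContinuousLinearMap.toSpanSingleton ℝ (∫ t in (0 : ℝ)..b, g' y t))
    (f₂ := fun y b => ContinuousLinearMap.toSpanSingleton ℝ (g y b))
    (.of_forall fun v => (hparam v.2 v.1).hasFDerivAt)
    (.of_forall fun v => (hprim v.1 v.2).hasFDerivAt)
    (by
      refine Continuous.continuousAt ?_
      refine (ContinuousLinearMap.toSpanSingletonCLE (𝕜 := ℝ) (E := ℝ)).continuous.comp ?_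
      exact intervalIntegral.continuous_parametric_primitive_of_continuous hg')
    ((ContinuousLinearMap.toSpanSingletonCLE (𝕜 := ℝ) (E := ℝ)).continuous.comp hg).continuousAt
  have := hP.hasFDerivAt.comp_hasDerivAt x ((hasDerivAt_id x).prodMk hs)
  simpa [Function.comp_def, Function.HasUncurry.uncurry] using this

/-- The Leibniz rule on the symmetric interval `[-x, x]`. -/
theorem hasDerivAt_integral_neg_self {g g' : ℝ → ℝ → ℝ}
    (hg : Continuous (Function.uncurry g)) (hg' : Continuous (Function.uncurry g'))
    (hd : ∀ x t, HasDerivAt (fun y => g y t) (g' x t) x) (x : ℝ) :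
    HasDerivAt (fun y => ∫ t in -y..y, g y t)
      ((∫ t in -x..x, g' x t) + (g x x + g x (-x))) x := by
  have hsplit {h : ℝ → ℝ} (hh : Continuous h) (y : ℝ) :
      ∫ t in -y..y, h t = (∫ t in (0 : ℝ)..y, h t) - ∫ t in (0 : ℝ)..-y, h t :=
    (intervalIntegral.integral_interval_sub_left (hh.intervalIntegrable _ _)
      (hh.intervalIntegrable _ _)).symm
  simp_rw [fun y => hsplit (hg.uncurry_left y) y, hsplit (hg'.uncurry_left x) x]
  refine ((hasDerivAt_integral_zero_variable hg hg' hd (hasDerivAt_id x)).sub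
    (hasDerivAt_integral_zero_variable hg hg' hd (hasDerivAt_neg x))).congr_deriv ?_
  simp only [id]
  ring

theorem fker_eq_ofScalarsSum :
    fker = FormalMultilinearSeries.ofScalarsSum (E := ℝ)
      (fun n : ℕ => (((1 : ℝ) / 4) ^ n / (n.factorial : ℝ)) ^ 2 * (-1) ^ n) := by
  ext m
  simp [fker, FormalMultilinearSeries.ofScalars_sum_eq]

theorem radius_fker_series :
    (FormalMultilinearSeries.ofScalars ℝ
      (fun n : ℕ => (((1 : ℝ) / 4) ^ n / (n.factorial : ℝ)) ^ 2 * (-1) ^ n)).radius = ⊤ := by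
  refine FormalMultilinearSeries.ofScalars_radius_eq_top_of_tendsto _ _
    (.of_forall fun n => by positivity) ?_
  have h : Tendsto (fun n : ℕ => (1 / 16 : ℝ) * (1 / ((n : ℝ) + 1)) ^ 2) atTop (𝓝 0) := by
    simpa using ((tendsto_one_div_add_atTop_nhds_zero_nat (𝕜 := ℝ)).pow 2).const_mul (1 / 16 : ℝ)
  refine h.congr fun n => ?_
  simp only [norm_mul, norm_pow, norm_div, norm_neg, norm_one, one_pow, mul_one,
    RCLike.norm_natCast, Nat.succ_eq_add_one, Nat.factorial_succ, Nat.cast_mul, Nat.cast_add,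
    Nat.cast_one]
  have : ‖(n : ℝ) + 1‖ = n + 1 := by rw [Real.norm_of_nonneg (by positivity)]
  have h4 : ‖(4 : ℝ)‖ = 4 := by norm_num
  simp only [this, h4, pow_succ]
  field_simp
  norm_num

theorem contDiff_fker : ContDiff ℝ 1 fker := by
  rw [fker_eq_ofScalarsSum]
  have h := (FormalMultilinearSeries.ofScalars ℝ
    (fun n : ℕ => (((1 : ℝ) / 4) ^ n / (n.factorial : ℝ)) ^ 2 * (-1) ^ n)).hasFPowerSeriesOnBall
    (by rw [radius_fker_series]; exact ENNReal.zero_lt_top)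
  have hA := h.analyticOnNhd
  rw [radius_fker_series, Metric.eball_top] at hA
  exact contDiffOn_univ.1 (hA.contDiffOn uniqueDiffOn_univ)

theorem fker_zero : fker 0 = 1 := by
  simp [fker_eq_ofScalarsSum]

/-- The normalised central binomial coefficient `4⁻ⁿ * (2n choose n)` squares to at most
`1 / (2n + 1)`. -/
theorem sq_centralBinom_div_four_pow_mul_le (n : ℕ) :
    ((n.centralBinom : ℝ) / 4 ^ n) ^ 2 * (2 * n + 1) ≤ 1 := by
  induction n with
  | zero => simp
  | succ n ih =>
    have h : ((n + 1 : ℕ).centralBinom : ℝ) = 2 * (2 * n + 1) / (n + 1) * n.centralBinom := by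
      have := Nat.succ_mul_centralBinom_succ n
      have h2 : ((n : ℝ) + 1) * (n + 1 : ℕ).centralBinom = 2 * (2 * n + 1) * n.centralBinom := by
        exact_mod_cast this
      field_simp
      linarith
    refine le_trans ?_ ih
    rw [h]
    have : (2 * (2 * (n : ℝ) + 1) / (n + 1) * n.centralBinom / 4 ^ (n + 1)) ^ 2
        * (2 * ((n + 1 : ℕ) : ℝ) + 1) = ((n.centralBinom : ℝ) / 4 ^ n) ^ 2 * (2 * n + 1) *
        ((2 * n + 1) * (2 * n + 3) / (2 * n + 2) ^ 2) := by
      push_cast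
      rw [pow_succ]
      field_simp
      ring
    rw [this]
    refine mul_le_of_le_one_right (by positivity) ?_
    rw [div_le_one (by positivity)]
    nlinarith

theorem tendsto_centralBinom_div_four_pow :
    Tendsto (fun n : ℕ => (n.centralBinom : ℝ) / 4 ^ n) atTop (𝓝 0) := by
  have h : Tendsto (fun n : ℕ => ((n.centralBinom : ℝ) / 4 ^ n) ^ 2) atTop (𝓝 0) := by
    refine squeeze_zero (fun n => by positivity) (fun n => ?_)
      (tendsto_one_div_add_atTop_nhds_zero_nat (𝕜 := ℝ))
    rw [le_div_iff₀ (by positivity)]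
    refine le_trans ?_ (sq_centralBinom_div_four_pow_mul_le n)
    gcongr
    linarith [(Nat.cast_nonneg n : (0 : ℝ) ≤ n)]
  simpa [Real.sqrt_sq_eq_abs, abs_div] using h.sqrt

theorem fker_neg_sq_term (x : ℝ) (n : ℕ) :
    (((1 : ℝ) / 4) ^ n / (n.factorial : ℝ)) ^ 2 * (-1) ^ n * (-(2 * x) ^ 2) ^ n =
      (n.centralBinom : ℝ) / 4 ^ n * (x ^ (2 * n) / (2 * n).factorial) := by
  have h : (n.centralBinom : ℝ) * (n.factorial * n.factorial) = (2 * n).factorial := by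
    have := Nat.choose_mul_factorial_mul_factorial (n := 2 * n) (k := n) (by omega)
    rw [show 2 * n - n = n by omega] at this
    rw [← this, Nat.centralBinom]
    push_cast
    ring
  rw [← h]
  have hc : (n.centralBinom : ℝ) ≠ 0 := by exact_mod_cast n.centralBinom_ne_zero
  have h4 : (-(2 * x) ^ 2) ^ n = (-1) ^ n * (4 ^ n * x ^ (2 * n)) := by
    rw [pow_mul, ← mul_pow, ← mul_pow]
    ring
  have h1 : ((-1 : ℝ) ^ n) * (-1) ^ n = 1 := by rw [← mul_pow]; simp
  calc _ = (((1 : ℝ) / 4) ^ n / (n.factorial : ℝ)) ^ 2 * (4 ^ n * x ^ (2 * n)) *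
        ((-1 : ℝ) ^ n * (-1) ^ n) := by rw [h4]; ring
    _ = _ := by
      rw [h1, one_div, inv_pow]
      field_simp

theorem summable_fker (m : ℝ) :
    Summable fun n : ℕ =>
      (((1 : ℝ) / 4) ^ n / (n.factorial : ℝ)) ^ 2 * (-1) ^ n * m ^ n := by
  have := (FormalMultilinearSeries.ofScalars ℝ
    (fun n : ℕ => (((1 : ℝ) / 4) ^ n / (n.factorial : ℝ)) ^ 2 * (-1) ^ n)).summable
    (x := m) (by rw [radius_fker_series, Metric.eball_top]; exact mem_univ m)
  simpa only [FormalMultilinearSeries.ofScalars_apply_eq, smul_eq_mul] using this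

theorem fker_term_of_neg (m : ℝ) (n : ℕ) :
    (((1 : ℝ) / 4) ^ n / (n.factorial : ℝ)) ^ 2 * (-1) ^ n * (-m) ^ n =
      (((1 : ℝ) / 4) ^ n / (n.factorial : ℝ)) ^ 2 * m ^ n := by
  rw [mul_assoc, ← mul_pow]
  simp

theorem fker_neg_nonneg {m : ℝ} (hm : 0 ≤ m) : 0 ≤ fker (-m) :=
  tsum_nonneg fun n => by rw [fker_term_of_neg]; positivity

theorem fker_neg_mono {m m' : ℝ} (hm : 0 ≤ m) (h : m ≤ m') : fker (-m) ≤ fker (-m') := by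
  refine (summable_fker _).tsum_le_tsum (fun n => ?_) (summable_fker _)
  rw [fker_term_of_neg, fker_term_of_neg]
  gcongr

/-- `e⁻ˣ I₀(x) → 0` as `x → ∞`, where `I₀(x) = fker (-(2x)²)` is the modified Bessel function. -/
theorem tendsto_exp_neg_mul_fker :
    Tendsto (fun x : ℝ => Real.exp (-x) * fker (-(2 * x) ^ 2)) atTop (𝓝 0) := by
  rw [Metric.tendsto_nhds]
  intro ε hε
  obtain ⟨N, hN⟩ := eventually_atTop.1
    (tendsto_centralBinom_div_four_pow.eventually_lt_const (half_pos hε))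
  set p : ℝ → ℝ := fun x => ∑ n ∈ Finset.range N,
    (n.centralBinom : ℝ) / 4 ^ n * (x ^ (2 * n) / (2 * n).factorial) with hp
  have hp0 : Tendsto (fun x => Real.exp (-x) * p x) atTop (𝓝 0) := by
    have : Tendsto (fun x : ℝ => ∑ n ∈ Finset.range N,
        (n.centralBinom : ℝ) / 4 ^ n / (2 * n).factorial * (x ^ (2 * n) * Real.exp (-x)))
        atTop (𝓝 (∑ n ∈ Finset.range N,
          (n.centralBinom : ℝ) / 4 ^ n / (2 * n).factorial * 0)) :=
      tendsto_finsetSum _ fun n _ =>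
        (Real.tendsto_pow_mul_exp_neg_atTop_nhds_zero (2 * n)).const_mul _
    simp only [mul_zero, Finset.sum_const_zero] at this
    refine this.congr fun x => ?_
    rw [hp, Finset.mul_sum]
    exact Finset.sum_congr rfl fun n _ => by ring
  filter_upwards [eventually_ge_atTop 0, hp0.eventually_lt_const (half_pos hε)] with x hx hpx
  have hnn : 0 ≤ fker (-(2 * x) ^ 2) := fker_neg_nonneg (sq_nonneg _)
  rw [Real.dist_eq, sub_zero, abs_of_nonneg (by positivity)]
  have hcosh := Real.hasSum_cosh x
  have hsum := summable_fker (-(2 * x) ^ 2)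
  have hbound : fker (-(2 * x) ^ 2) ≤ p x + ε / 2 * Real.cosh x := by
    have hind : Summable fun n : ℕ => if n ∈ Finset.range N then
        (n.centralBinom : ℝ) / 4 ^ n * (x ^ (2 * n) / (2 * n).factorial) else 0 :=
      summable_of_ne_finset_zero (s := Finset.range N) fun n hn => if_neg hn
    have hpsum : p x = ∑' n : ℕ, if n ∈ Finset.range N then
        (n.centralBinom : ℝ) / 4 ^ n * (x ^ (2 * n) / (2 * n).factorial) else 0 := by
      rw [tsum_eq_sum (s := Finset.range N) fun n hn => if_neg hn]
      exact Finset.sum_congr rfl fun n hn => (if_pos hn).symm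
    rw [hpsum, ← hcosh.tsum_eq, ← tsum_mul_left,
      ← hind.tsum_add (hcosh.summable.mul_left _)]
    refine hsum.tsum_le_tsum (fun n => ?_) (hind.add (hcosh.summable.mul_left _))
    rw [fker_neg_sq_term]
    split_ifs with hn
    · exact le_add_of_nonneg_right (by positivity)
    · rw [zero_add]
      exact mul_le_mul_of_nonneg_right (hN n (by simpa using hn)).le (by positivity)
  have hcosh1 : Real.exp (-x) * Real.cosh x ≤ 1 := by
    have h1 : Real.exp (-x) ≤ 1 := Real.exp_le_one_iff.2 (by linarith)
    have h2 : Real.exp (-x) * Real.exp x = 1 := by rw [← Real.exp_add]; simp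
    rw [Real.cosh_eq]
    nlinarith [Real.exp_pos (-x)]
  calc Real.exp (-x) * fker (-(2 * x) ^ 2)
      ≤ Real.exp (-x) * (p x + ε / 2 * Real.cosh x) := by gcongr
    _ = Real.exp (-x) * p x + ε / 2 * (Real.exp (-x) * Real.cosh x) := by ring
    _ < ε / 2 + ε / 2 * 1 := add_lt_add_of_lt_of_le hpx (by gcongr)
    _ = ε := by ring

theorem chiKer_eq_zero {R u : ℝ} (h : |R| < |u|) : chiKer R u = 0 :=
  if_neg (not_le.2 (sq_lt_sq.2 h))

theorem tendsto_chiKer_atBot (u : ℝ) : Tendsto (fun R => chiKer R u) atBot (𝓝 0) := by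
  have h : Tendsto (fun R : ℝ => Real.exp (-(-R / 2)) * fker (-(2 * (-R / 2)) ^ 2))
      atBot (𝓝 0) :=
    tendsto_exp_neg_mul_fker.comp (tendsto_neg_atBot_atTop.atTop_div_const two_pos)
  refine squeeze_zero (fun R => ?_) (fun R => ?_) h
  · unfold chiKer
    split_ifs with hR
    · have := fker_neg_nonneg (sub_nonneg.2 hR)
      rw [neg_sub] at this
      positivity
    · rfl
  · rw [show -(-R / 2) = R / 2 by ring, show 2 * (-R / 2) = -R by ring, neg_sq]
    unfold chiKer
    split_ifs with hR
    · have := fker_neg_mono (sub_nonneg.2 hR) (sub_le_self (R ^ 2) (sq_nonneg u))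
      rw [neg_sub] at this
      gcongr
    · exact mul_nonneg (Real.exp_pos _).le (fker_neg_nonneg (sq_nonneg R))

theorem integral_chiKer_mul (φ : ℝ → ℝ) (R : ℝ) :
    ∫ u, chiKer R u * φ u =
      ∫ u in -|R|..|R|, Real.exp (R / 2) * fker (u ^ 2 - R ^ 2) * φ u := by
  rw [intervalIntegral.integral_of_le (neg_le_self (abs_nonneg R)), ← integral_Icc_eq_integral_Ioc,
    ← integral_indicator measurableSet_Icc]
  congr 1
  ext u
  by_cases h : u ^ 2 ≤ R ^ 2
  · rw [indicator_of_mem (mem_Icc.2 (abs_le.1 (sq_le_sq.1 h))), chiKer, if_pos h]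
  · rw [indicator_of_notMem (fun hu => h (sq_le_sq.2 (abs_le.2 (mem_Icc.1 hu)))), chiKer, if_neg h, zero_mul]

theorem continuous_integral_chiKer_mul {φ : ℝ → ℝ} (hφ : Continuous φ) :
    Continuous fun R => ∫ u, chiKer R u * φ u := by
  simp_rw [integral_chiKer_mul]
  have hf := contDiff_fker.continuous
  have hg : Continuous (Function.uncurry
      fun R u : ℝ => Real.exp (R / 2) * fker (u ^ 2 - R ^ 2) * φ u) := by
    unfold Function.uncurry
    fun_prop
  have hsplit (R : ℝ) : ∫ u in -|R|..|R|, Real.exp (R / 2) * fker (u ^ 2 - R ^ 2) * φ u =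
      (∫ u in (0 : ℝ)..|R|, Real.exp (R / 2) * fker (u ^ 2 - R ^ 2) * φ u) -
        ∫ u in (0 : ℝ)..-|R|, Real.exp (R / 2) * fker (u ^ 2 - R ^ 2) * φ u :=
    (intervalIntegral.integral_interval_sub_left ((hg.uncurry_left R).intervalIntegrable _ _)
      ((hg.uncurry_left R).intervalIntegrable _ _)).symm
  simp_rw [hsplit]
  exact (intervalIntegral.continuous_parametric_intervalIntegral_of_continuous hg
    continuous_abs).sub (intervalIntegral.continuous_parametric_intervalIntegral_of_continuous hg
    continuous_abs.neg)

/-- The derivative of `R ↦ ∫ u in -R..R, exp (R / 2) * fker (u ^ 2 - R ^ 2) * φ u`. -/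
def chiDeriv (φ : ℝ → ℝ) (R : ℝ) : ℝ :=
  (∫ u in -R..R, φ u * Real.exp (R / 2) *
    (fker (u ^ 2 - R ^ 2) / 2 - 2 * R * deriv fker (u ^ 2 - R ^ 2))) +
  Real.exp (R / 2) * (φ R + φ (-R))

theorem continuous_chiDeriv {φ : ℝ → ℝ} (hφ : Continuous φ) : Continuous (chiDeriv φ) := by
  have hf := contDiff_fker.continuous
  have hf' := contDiff_fker.continuous_deriv le_rfl
  have hg : Continuous (Function.uncurry fun R u : ℝ => φ u * Real.exp (R / 2) *
      (fker (u ^ 2 - R ^ 2) / 2 - 2 * R * deriv fker (u ^ 2 - R ^ 2))) := by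
    unfold Function.uncurry
    fun_prop
  have hsplit (R : ℝ) : ∫ u in -R..R, φ u * Real.exp (R / 2) *
      (fker (u ^ 2 - R ^ 2) / 2 - 2 * R * deriv fker (u ^ 2 - R ^ 2)) =
      (∫ u in (0 : ℝ)..R, φ u * Real.exp (R / 2) *
        (fker (u ^ 2 - R ^ 2) / 2 - 2 * R * deriv fker (u ^ 2 - R ^ 2))) -
      ∫ u in (0 : ℝ)..-R, φ u * Real.exp (R / 2) *
        (fker (u ^ 2 - R ^ 2) / 2 - 2 * R * deriv fker (u ^ 2 - R ^ 2)) :=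
    (intervalIntegral.integral_interval_sub_left ((hg.uncurry_left R).intervalIntegrable _ _)
      ((hg.uncurry_left R).intervalIntegrable _ _)).symm
  unfold chiDeriv
  simp_rw [hsplit]
  exact ((intervalIntegral.continuous_parametric_intervalIntegral_of_continuous hg
    continuous_id).sub (intervalIntegral.continuous_parametric_intervalIntegral_of_continuous hg
    continuous_neg)).add (by fun_prop)

theorem chiDeriv_zero (φ : ℝ → ℝ) : chiDeriv φ 0 = 2 * φ 0 := by
  simp [chiDeriv, two_mul]

theorem hasDerivAt_integral_fker {φ : ℝ → ℝ} (hφ : Continuous φ) (R : ℝ) :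
    HasDerivAt (fun R => ∫ u in -R..R, Real.exp (R / 2) * fker (u ^ 2 - R ^ 2) * φ u)
      (chiDeriv φ R) R := by
  have hf := contDiff_fker.continuous
  have hf' := contDiff_fker.continuous_deriv le_rfl
  convert hasDerivAt_integral_neg_self
    (g := fun R u => Real.exp (R / 2) * fker (u ^ 2 - R ^ 2) * φ u)
    (g' := fun R u => φ u * Real.exp (R / 2) *
      (fker (u ^ 2 - R ^ 2) / 2 - 2 * R * deriv fker (u ^ 2 - R ^ 2))) ?_ ?_ ?_ R using 1
  · simp only [chiDeriv, sub_self, neg_sq, fker_zero]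
    ring
  · unfold Function.uncurry
    fun_prop
  · unfold Function.uncurry
    fun_prop
  · intro R u
    have h1 : HasDerivAt (fun R : ℝ => Real.exp (R / 2)) (Real.exp (R / 2) * (1 / 2)) R :=
      ((hasDerivAt_id R).div_const 2).exp
    have h2 : HasDerivAt (fun R : ℝ => u ^ 2 - R ^ 2) (-(2 * R)) R := by
      simpa using ((hasDerivAt_id R).pow 2).const_sub (u ^ 2)
    have h3 := ((contDiff_fker.differentiable one_ne_zero) (u ^ 2 - R ^ 2)).hasDerivAt.comp R h2
    refine ((h1.mul h3).mul_const (φ u)).congr_deriv ?_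
    simp only [Function.comp_apply]
    ring

theorem hasDerivAt_integral_chiKer_of_pos {φ : ℝ → ℝ} (hφ : Continuous φ) {R : ℝ} (hR : 0 < R) :
    HasDerivAt (fun R => ∫ u, chiKer R u * φ u) (chiDeriv φ R) R := by
  refine (hasDerivAt_integral_fker hφ R).congr_of_eventuallyEq ?_
  filter_upwards [lt_mem_nhds hR] with S hS
  rw [integral_chiKer_mul, abs_of_pos hS]

theorem hasDerivAt_integral_chiKer_of_neg {φ : ℝ → ℝ} (hφ : Continuous φ) {R : ℝ} (hR : R < 0) :
    HasDerivAt (fun R => ∫ u, chiKer R u * φ u) (-chiDeriv φ R) R := by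
  refine (hasDerivAt_integral_fker hφ R).neg.congr_of_eventuallyEq ?_
  filter_upwards [gt_mem_nhds hR] with S hS
  rw [integral_chiKer_mul, abs_of_neg hS, neg_neg, Pi.neg_apply,
    intervalIntegral.integral_symm]

/-- Lemma 4.3: properties of the entropy kernel `χ`.
(i) `χ(R,u) = 0` for `|u| > |R|`; (ii) `χ(R,u) → 0` as `R → −∞` for fixed `u`;
(iii) `∫ χ(R,u) φ(u) du → 0` as `R → 0`; (iv) for `R ≠ 0` the map
`R ↦ ∫ χ(R,u) φ(u) du` is differentiable with the explicit derivative below,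
which tends to `±2 φ(0)` as `R → 0±`. -/
theorem chi_kernel_properties :
    (∀ R u : ℝ, |R| < |u| → chiKer R u = 0) ∧
    (∀ u : ℝ, Tendsto (fun R => chiKer R u) atBot (𝓝 0)) ∧
    (∀ φ : ℝ → ℝ, ContDiff ℝ (⊤ : ℕ∞) φ → HasCompactSupport φ →
      Tendsto (fun R => ∫ u : ℝ, chiKer R u * φ u) (𝓝 0) (𝓝 0)) ∧
    (∀ φ : ℝ → ℝ, ContDiff ℝ (⊤ : ℕ∞) φ → HasCompactSupport φ →
      (∀ R : ℝ, R ≠ 0 →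
        HasDerivAt (fun R' => ∫ u : ℝ, chiKer R' u * φ u)
          ((∫ u in Set.Ioo (-|R|) |R|,
              φ u * Real.exp (R / 2) *
                (fker (u ^ 2 - R ^ 2) / 2 - 2 * R * deriv fker (u ^ 2 - R ^ 2)))
            + Real.exp (R / 2) * (φ R + φ (-R)) *
                ((if 0 < R then (1 : ℝ) else 0) - (if R < 0 then 1 else 0))) R) ∧
      Tendsto (fun R => deriv (fun R' => ∫ u : ℝ, chiKer R' u * φ u) R)
        (𝓝[>] 0) (𝓝 (2 * φ 0)) ∧
      Tendsto (fun R => deriv (fun R' => ∫ u : ℝ, chiKer R' u * φ u) R)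
        (𝓝[<] 0) (𝓝 (-2 * φ 0))) := by
  refine ⟨fun R u => chiKer_eq_zero, tendsto_chiKer_atBot, fun φ hφ _ => ?_,
    fun φ hφ _ => ⟨fun R hR => ?_, ?_, ?_⟩⟩
  · have h := (continuous_integral_chiKer_mul hφ.continuous).tendsto 0
    simpa [integral_chiKer_mul φ 0] using h
  · rw [← integral_Ioc_eq_integral_Ioo,
      ← intervalIntegral.integral_of_le (neg_le_self (abs_nonneg R))]
    rcases hR.lt_or_gt with h | h
    · convert hasDerivAt_integral_chiKer_of_neg hφ.continuous h using 1
      rw [abs_of_neg h, neg_neg, if_neg h.not_gt, if_pos h, chiDeriv,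
        intervalIntegral.integral_symm (-R) R]
      ring
    · convert hasDerivAt_integral_chiKer_of_pos hφ.continuous h using 1
      rw [abs_of_pos h, if_neg h.not_gt, if_pos h, chiDeriv]
      ring
  · rw [← chiDeriv_zero φ]
    refine (((continuous_chiDeriv hφ.continuous).tendsto 0).mono_left nhdsWithin_le_nhds).congr' ?_
    filter_upwards [self_mem_nhdsWithin] with R hR
    exact (hasDerivAt_integral_chiKer_of_pos hφ.continuous hR).deriv.symm
  · rw [neg_mul, ← chiDeriv_zero φ]
    refine (((continuous_chiDeriv hφ.continuous).tendsto 0).neg.mono_left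
      nhdsWithin_le_nhds).congr' ?_
    filter_upwards [self_mem_nhdsWithin] with R hR
    exact (hasDerivAt_integral_chiKer_of_neg hφ.continuous hR).deriv.symm
end
end

section
/- Let A = 1/4 and f(m) = Σ_{n≥0} (A^n/n!)² (−1)^n m^n. Fix R ∈ ℝ and s ∈ ℝ, and define H(u) := |u−s| + ∫_{−max(|R|,|u−s|)}^{−|u−s|} e^{r/2} f(|u−s|² − r²) dr. Then at every point u with u ≠ s and |u−s| ≠ |R|, the function H is differentiable in u and ∂H/∂u (u) = sgn(u−s) ( 1 − e^{−|u−s|/2} 1_{|u−s| < |R|} ) + 2 ∫_{−max(|R|,|u−s|)}^{−|u−s|} (u−s) e^{r/2} f'(|u−s|² − r²) dr. Consequently the entropy-flux kernel h(R, u−s) := ∂/∂s [ H ] = sgn(u−s) ( e^{−|u−s|/2} 1_{|u−s|<|R|} − 1 ) − 2 ∫_{−max(|R|,|u−s|)}^{−|u−s|} (u−s) e^{r/2} f'(|u−s|² − r²) dr. -/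
open MeasureTheory Real Set Filter Topology

noncomputable section

/-- The function `H(R,u,s) = |u−s| + ∫_{−max(|R|,|u−s|)}^{−|u−s|} e^{r/2}
f(|u−s|² − r²) dr` generating the entropy-flux kernel. -/
def HKer (R u s : ℝ) : ℝ :=
  |u - s| + ∫ r in (-(max |R| |u - s|))..(-|u - s|),
    Real.exp (r / 2) * fker ((u - s) ^ 2 - r ^ 2)

theorem analyticOnNhd_fker : AnalyticOnNhd ℝ fker univ := by
  set c : ℕ → ℝ := fun n => (((1 : ℝ) / 4) ^ n / (n.factorial : ℝ)) ^ 2 * (-1) ^ n with hc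
  have hne : ∀ n, c n ≠ 0 := fun n => by simp [hc, Nat.factorial_ne_zero]
  have hratio : ∀ n : ℕ, ‖c n.succ‖ / ‖c n‖ = (1 / 16) * (1 / ((n : ℝ) + 1)) ^ 2 := fun n => by
    have hn : (n.factorial : ℝ) ≠ 0 := by exact_mod_cast n.factorial_ne_zero
    have hn' : (n : ℝ) + 1 ≠ 0 := by positivity
    simp only [hc, norm_mul, norm_pow, norm_div, norm_neg, norm_one, one_pow, mul_one,
      Nat.succ_eq_add_one, Nat.factorial_succ, Nat.cast_mul, Nat.cast_add, Nat.cast_one,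
      Real.norm_natCast, Real.norm_ofNat, pow_succ (1 / 4 : ℝ)]
    rw [Real.norm_of_nonneg (by positivity : (0 : ℝ) ≤ (n : ℝ) + 1)]
    field_simp
    norm_num
  have hlim : Tendsto (fun n : ℕ => ‖c n.succ‖ / ‖c n‖) atTop (𝓝 0) := by
    simp_rw [hratio]
    simpa using ((tendsto_one_div_add_atTop_nhds_zero_nat (𝕜 := ℝ)).pow 2).const_mul (1 / 16 : ℝ)
  have hrad : (FormalMultilinearSeries.ofScalars ℝ c).radius = ⊤ :=
    FormalMultilinearSeries.ofScalars_radius_eq_top_of_tendsto ℝ c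
      (Eventually.of_forall hne) hlim
  have hsum : fker = (FormalMultilinearSeries.ofScalars ℝ c).sum :=
    (FormalMultilinearSeries.ofScalarsSum_eq_tsum (E := ℝ) (c := c)).symm
  have hball := (FormalMultilinearSeries.ofScalars ℝ c).hasFPowerSeriesOnBall
    (by rw [hrad]; exact ENNReal.zero_lt_top)
  rw [hrad, ← hsum] at hball
  simpa using hball.analyticOnNhd

/-- Differentiation under the integral sign, with a fixed interval and a jointly continuous
partial derivative. -/
theorem hasDerivAt_integral_of_continuous_deriv {g g' : ℝ → ℝ → ℝ}
    (hg : Continuous (Function.uncurry g)) (hg' : Continuous (Function.uncurry g'))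
    (hd : ∀ x r, HasDerivAt (fun y => g y r) (g' x r) x) (a b x : ℝ) :
    HasDerivAt (fun y => ∫ r in a..b, g y r) (∫ r in a..b, g' x r) x := by
  obtain ⟨C, hC⟩ := ((isCompact_closedBall x 1).prod (isCompact_uIcc (a := a) (b := b)))
    |>.exists_bound_of_continuousOn hg'.continuousOn
  have hgx : ∀ y, Continuous (g y) := fun y => hg.comp (Continuous.prodMk_right y)
  have hgx' : ∀ y, Continuous (g' y) := fun y => hg'.comp (Continuous.prodMk_right y)
  refine (intervalIntegral.hasDerivAt_integral_of_dominated_loc_of_deriv_le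
    (bound := fun _ => C) (Metric.closedBall_mem_nhds x one_pos)
    (Eventually.of_forall fun y => (hgx y).aestronglyMeasurable)
    ((hgx x).intervalIntegrable a b) (hgx' x).aestronglyMeasurable ?_
    intervalIntegrable_const ?_).2
  · exact Eventually.of_forall fun r hr y hy => hC (y, r) ⟨hy, uIoc_subset_uIcc hr⟩
  · exact Eventually.of_forall fun r _ y _ => hd y r

/-- The Leibniz integral rule with a moving upper endpoint. -/
theorem hasDerivAt_integral_moving_endpoint {g g' : ℝ → ℝ → ℝ}
    (hg : Continuous (Function.uncurry g)) (hg' : Continuous (Function.uncurry g'))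
    (hd : ∀ x r, HasDerivAt (fun y => g y r) (g' x r) x) (a x : ℝ) {b : ℝ → ℝ} {b' : ℝ}
    (hb : HasDerivAt b b' x) :
    HasDerivAt (fun y => ∫ r in a..b y, g y r)
      ((∫ r in a..b x, g' x r) + b' * g x (b x)) x := by
  have hgx : ∀ y, Continuous (g y) := fun y => hg.comp (Continuous.prodMk_right y)
  have key := hasStrictFDerivAt_uncurry_coprod (𝕜 := ℝ) (u := (x, b x))
    (f := fun y t => ∫ r in a..t, g y r)
    (f₁ := fun y t => ContinuousLinearMap.toSpanSingleton ℝ (∫ r in a..t, g' y r))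
    (f₂ := fun y t => ContinuousLinearMap.toSpanSingleton ℝ (g y t))
    (Eventually.of_forall fun v =>
      (hasDerivAt_integral_of_continuous_deriv hg hg' hd a v.2 v.1).hasFDerivAt)
    (Eventually.of_forall fun v =>
      (intervalIntegral.integral_hasDerivAt_right ((hgx v.1).intervalIntegrable _ _)
        ((hgx v.1).stronglyMeasurableAtFilter _ _) (hgx v.1).continuousAt).hasFDerivAt)
    ((ContinuousLinearMap.toSpanSingletonCLE (𝕜 := ℝ) (E := ℝ)).continuous.comp
      (intervalIntegral.continuous_parametric_primitive_of_continuous hg')).continuousAt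
    ((ContinuousLinearMap.toSpanSingletonCLE (𝕜 := ℝ) (E := ℝ)).continuous.comp hg).continuousAt
  have h := key.hasFDerivAt.comp_hasDerivAt x ((hasDerivAt_id x).prodMk hb)
  simpa [Function.HasUncurry.uncurry, Function.comp_def] using h

theorem hasDerivAt_abs_sign {w : ℝ} (hw : w ≠ 0) :
    HasDerivAt (fun x : ℝ => |x|) (Real.sign w) w := by
  rcases hw.lt_or_gt with h | h
  · rw [Real.sign_of_neg h]
    exact hasDerivAt_abs_neg h
  · rw [Real.sign_of_pos h]
    exact hasDerivAt_abs_pos h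

/-- The derivative of the function generating the entropy-flux kernel, in the variable
`w = u - s`. -/
theorem hasDerivAt_HKer_zero (R : ℝ) {w : ℝ} (hw : w ≠ 0) (hwR : |w| ≠ |R|) :
    HasDerivAt (fun x => HKer R x 0)
      (Real.sign w * (1 - Real.exp (-|w| / 2) * (if |w| < |R| then 1 else 0))
        + 2 * ∫ r in (-(max |R| |w|))..(-|w|),
            w * Real.exp (r / 2) * deriv fker (w ^ 2 - r ^ 2)) w := by
  have habs := hasDerivAt_abs_sign hw
  simp only [HKer, sub_zero]
  rcases hwR.lt_or_gt with h | h
  · have hf := contDiff_fker.continuous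
    have hf' := contDiff_fker.continuous_deriv le_rfl
    have hint := hasDerivAt_integral_moving_endpoint
      (g := fun y r => Real.exp (r / 2) * fker (y ^ 2 - r ^ 2))
      (g' := fun y r => 2 * (y * Real.exp (r / 2) * deriv fker (y ^ 2 - r ^ 2)))
      (by unfold Function.uncurry; fun_prop)
      (by unfold Function.uncurry; fun_prop)
      (fun y r => by
        have h1 : HasDerivAt (fun y : ℝ => y ^ 2 - r ^ 2) (2 * y) y := by
          simpa using (hasDerivAt_pow 2 y).sub_const (r ^ 2)
        have h2 := (contDiff_fker.differentiable one_ne_zero (y ^ 2 - r ^ 2)).hasDerivAt.comp y h1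
        exact (h2.const_mul (Real.exp (r / 2))).congr_deriv (by ring))
      (-|R|) w habs.neg
    have hmax : ∀ᶠ x : ℝ in 𝓝 w, max |R| |x| = |R| := by
      filter_upwards [continuous_abs.continuousAt.eventually_lt continuousAt_const h] with x hx
      exact max_eq_left hx.le
    rw [if_pos h, max_eq_left h.le]
    refine ((habs.add hint).congr_of_eventuallyEq ?_).congr_deriv ?_
    · filter_upwards [hmax] with x hx
      simp [hx]
    · simp only [Pi.neg_apply, even_two.neg_pow, sq_abs, sub_self, fker_zero,
        intervalIntegral.integral_const_mul]
      ring
  · rw [if_neg h.not_gt, max_eq_right h.le]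
    refine (habs.congr_of_eventuallyEq ?_).congr_deriv (by simp)
    filter_upwards [continuousAt_const.eventually_lt continuous_abs.continuousAt h] with x hx
    simp [max_eq_right hx.le]

/-- Theorem 4.5: the entropy-flux kernel.  At every point
with `u ≠ s` and `|u−s| ≠ |R|`, the function `H` is differentiable in `u` with
`∂H/∂u = sgn(u−s)(1 − e^{−|u−s|/2} 1_{|u−s|<|R|}) + 2 ∫ (u−s) e^{r/2} f'(…) dr`,
and consequently the entropy-flux kernel `h = ∂H/∂s` equals
`sgn(u−s)(e^{−|u−s|/2} 1_{|u−s|<|R|} − 1) − 2 ∫ (u−s) e^{r/2} f'(…) dr`. -/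
theorem entropy_flux_kernel_derivative (R s : ℝ) :
    ∀ u : ℝ, u ≠ s → |u - s| ≠ |R| →
      HasDerivAt (fun u' => HKer R u' s)
        (Real.sign (u - s) *
            (1 - Real.exp (-|u - s| / 2) * (if |u - s| < |R| then 1 else 0))
          + 2 * ∫ r in (-(max |R| |u - s|))..(-|u - s|),
              (u - s) * Real.exp (r / 2) * deriv fker ((u - s) ^ 2 - r ^ 2)) u ∧
      HasDerivAt (fun s' => HKer R u s')
        (Real.sign (u - s) *
            (Real.exp (-|u - s| / 2) * (if |u - s| < |R| then 1 else 0) - 1)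
          - 2 * ∫ r in (-(max |R| |u - s|))..(-|u - s|),
              (u - s) * Real.exp (r / 2) * deriv fker ((u - s) ^ 2 - r ^ 2)) s := by
  intro u hus huR
  have h := hasDerivAt_HKer_zero R (sub_ne_zero.mpr hus) huR
  have hH : ∀ u' s', HKer R u' s' = HKer R (u' - s') 0 := fun u' s' => by simp [HKer]
  rw [funext fun u' => hH u' s, funext fun s' => hH u s']
  refine ⟨h.comp_sub_const u s, ?_⟩
  exact (h.comp_const_sub u s).congr_deriv (by ring)
end
end

section
/- Let A = 1/4, f(m) = Σ_{n≥0} (A^n/n!)² (−1)^n m^n, and χ(R,u) := e^{R/2} f(u² − R²) · 1_{u² ≤ R²}. Then for every fixed R ≠ 0 and u ∈ ℝ and every test function φ ∈ C_c^∞(ℝ), ∫_ℝ χ(R, u−s) φ'(s) ds = e^{R/2} ( φ(u+|R|) − φ(u−|R|) ) + 2 e^{R/2} ∫_{u−|R|}^{u+|R|} (u−s) f'((u−s)² − R²) φ(s) ds. Equivalently, the distributional derivative ∂_s [χ(R,u−s)] is the sum of the Dirac measures e^{R/2} (δ_{s=u−|R|} − δ_{s=u+|R|}) and a bounded function supported in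 {|u−s| < |R|}. -/
open MeasureTheory Real Set Filter Topology

noncomputable section

/-- Theorem 4.6: singularities of the entropy kernel.  For
fixed `R ≠ 0` and `u`, the distributional derivative `∂_s [χ(R, u−s)]` consists
of the Dirac masses `e^{R/2}(δ_{s=u−|R|} − δ_{s=u+|R|})` plus a bounded part
supported in `{|u−s| < |R|}`: for every test function `φ ∈ C_c^∞(ℝ)`,
`∫ χ(R,u−s) φ'(s) ds = e^{R/2}(φ(u+|R|) − φ(u−|R|))
  + 2 e^{R/2} ∫_{u−|R|}^{u+|R|} (u−s) f'((u−s)²−R²) φ(s) ds`. -/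
theorem chi_s_derivative_singularities
    (R : ℝ) (hR : R ≠ 0) (u : ℝ)
    (φ : ℝ → ℝ) (hφ : ContDiff ℝ (⊤ : ℕ∞) φ) (hsupp : HasCompactSupport φ) :
    ∫ s : ℝ, chiKer R (u - s) * deriv φ s
      = Real.exp (R / 2) * (φ (u + |R|) - φ (u - |R|))
        + 2 * Real.exp (R / 2) *
            ∫ s in (u - |R|)..(u + |R|),
              (u - s) * deriv fker ((u - s) ^ 2 - R ^ 2) * φ s := by
  have hf := contDiff_fker
  have hf' : Continuous (deriv fker) := hf.continuous_deriv le_rfl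
  have hφ' : Continuous (deriv φ) := hφ.continuous_deriv (by simp)
  have hindicator : (fun s => chiKer R (u - s) * deriv φ s) =
      (Icc (u - |R|) (u + |R|)).indicator
        (fun s => Real.exp (R / 2) * (fker ((u - s) ^ 2 - R ^ 2) * deriv φ s)) := by
    ext s
    have hiff : (u - s) ^ 2 ≤ R ^ 2 ↔ s ∈ Icc (u - |R|) (u + |R|) := by
      rw [sq_le_sq, abs_le, mem_Icc]
      constructor <;> rintro ⟨h₁, h₂⟩ <;> constructor <;> linarith
    by_cases h : s ∈ Icc (u - |R|) (u + |R|)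
    · rw [indicator_of_mem h, chiKer, if_pos (hiff.2 h), mul_assoc]
    · rw [indicator_of_notMem h, chiKer, if_neg (mt hiff.1 h), zero_mul]
  have hle : u - |R| ≤ u + |R| := by linarith [abs_nonneg R]
  have hderiv (s : ℝ) : HasDerivAt (fun s => fker ((u - s) ^ 2 - R ^ 2))
      (-2 * ((u - s) * deriv fker ((u - s) ^ 2 - R ^ 2))) s := by
    have h₁ : HasDerivAt (fun s => (u - s) ^ 2 - R ^ 2) (-2 * (u - s)) s :=
      ((((hasDerivAt_id s).const_sub u).pow 2).sub_const (R ^ 2)).congr_deriv (by simp)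
    have h₂ := ((hf.differentiable one_ne_zero) ((u - s) ^ 2 - R ^ 2)).hasDerivAt
    have h₃ := h₂.comp s h₁
    exact h₃.congr_deriv (by ring)
  have hparts := intervalIntegral.integral_mul_deriv_eq_deriv_mul
    (a := u - |R|) (b := u + |R|) (fun s _ => hderiv s)
    (fun s _ => ((hφ.differentiable (by simp)) s).hasDerivAt)
    (Continuous.intervalIntegrable (by fun_prop) _ _) (hφ'.intervalIntegrable _ _)
  rw [hindicator, integral_indicator measurableSet_Icc, integral_Icc_eq_integral_Ioc,
    ← intervalIntegral.integral_of_le hle, intervalIntegral.integral_const_mul, hparts]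
  simp only [sub_sub_cancel, sub_add_cancel_left, neg_sq, sq_abs, sub_self, fker_zero, mul_assoc,
    intervalIntegral.integral_const_mul]
  ring
end
end
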